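/- arXiv:1703.00438 — 2 statements merged into one kernel-verified Lean document; each statement's English description precedes it below -/
import Mathlib

section
/- Suppose g_1,…,g_n ∈ S is a regular sequence of homogeneous forms of degree d such that, for some 1 ≤ a ≤ n−1, the forms g_{a+1},…,g_n lie in k[x_{a+1},…,x_n]. Then: (i) g_{a+1},…,g_n is a regular sequence in k[x_{a+1},…,x_n]; (ii) the truncations g_i' := g_i(x_1,…,x_a,0,…,0), for i = 1,…,a, form a regular sequence of homogeneous forms of degree d in k[x_1,…,x_a]; and consequently (iii) g_1',…,g_a', g_{a+1},…,g_n is a regular sequence in S, so (g_1',…,g_a',g_{a+1},…,g_n) is a balanced complete intersection ideal of type (d)^n. -/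
open MvPolynomial

/-- `RegularModulo K l` says that `l` is weakly regular on the quotient by the ideal `K`, phrased
through membership in ideals of the ambient ring. -/
def RegularModulo {A : Type*} [CommRing A] : Ideal A → List A → Prop
  | _, [] => True
  | K, g :: l => (∀ w, g * w ∈ K → w ∈ K) ∧ RegularModulo (K ⊔ Ideal.span {g}) l

namespace RegularModulo

section Basic

variable {A B : Type*} [CommRing A] [CommRing B]

open scoped Pointwise in
lemma isWeaklyRegular_quotient_iff (l : List A) (K : Ideal A) :
    RingTheory.Sequence.IsWeaklyRegular (A ⧸ K) l ↔ RegularModulo K l := by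
  induction l generalizing K with
  | nil => simp [RegularModulo]
  | cons g l ih =>
    have hr : IsSMulRegular (A ⧸ K) g ↔ ∀ w, g * w ∈ K → w ∈ K := by
      rw [isSMulRegular_iff_right_eq_zero_of_smul]
      constructor
      · intro h w hw
        have := h (Ideal.Quotient.mk K w) (by
          rw [← Ideal.Quotient.mk_eq_mk, ← Submodule.Quotient.mk_smul]
          exact (Submodule.Quotient.mk_eq_zero K).2 hw)
        exact Ideal.Quotient.eq_zero_iff_mem.1 this
      · intro h x hx
        obtain ⟨w, rfl⟩ := Ideal.Quotient.mk_surjective x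
        rw [← Ideal.Quotient.mk_eq_mk, ← Submodule.Quotient.mk_smul] at hx
        exact Ideal.Quotient.eq_zero_iff_mem.2 (h w ((Submodule.Quotient.mk_eq_zero K).1 hx))
    have e : QuotSMulTop g (A ⧸ K) ≃ₗ[A] A ⧸ (K ⊔ Ideal.span {g}) := by
      have h : (g • ⊤ : Submodule A (A ⧸ K)) = Submodule.map K.mkQ (K ⊔ Ideal.span {g}) := by
        rw [Submodule.map_sup]
        rw [Submodule.mkQ_map_self, bot_sup_eq, ← Submodule.ideal_span_singleton_smul,
          ← (Submodule.range_mkQ K), LinearMap.range_eq_map, ← Submodule.map_smul'']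
        simp
      exact (Submodule.quotEquivOfEq _ _ h).trans
        (Submodule.quotientQuotientEquivQuotient K (K ⊔ Ideal.span {g}) le_sup_left)
    rw [RingTheory.Sequence.isWeaklyRegular_cons_iff, e.isWeaklyRegular_congr, ih, hr]
    rfl

lemma isWeaklyRegular_iff (l : List A) :
    RingTheory.Sequence.IsWeaklyRegular A l ↔ RegularModulo ⊥ l := by
  rw [← isWeaklyRegular_quotient_iff]
  exact (Submodule.quotEquivOfEqBot (⊥ : Ideal A) rfl).symm.isWeaklyRegular_congr l

lemma isRegular_iff (l : List A) :
    RingTheory.Sequence.IsRegular A l ↔ RegularModulo ⊥ l ∧ Ideal.ofList l ≠ ⊤ := by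
  rw [RingTheory.Sequence.isRegular_iff, isWeaklyRegular_iff]
  simp [ne_comm]

lemma append_iff (l₁ l₂ : List A) (K : Ideal A) :
    RegularModulo K (l₁ ++ l₂) ↔
      RegularModulo K l₁ ∧ RegularModulo (K ⊔ Ideal.ofList l₁) l₂ := by
  induction l₁ generalizing K with
  | nil => simp [RegularModulo]
  | cons g l ih => simp [RegularModulo, ih, and_assoc, sup_assoc]

lemma map_iff {f : A →+* B} (hf : Function.Surjective f) (l : List A) (K : Ideal A)
    (hK : RingHom.ker f ≤ K) :
    RegularModulo K l ↔ RegularModulo (K.map f) (l.map f) := by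
  induction l generalizing K with
  | nil => simp [RegularModulo]
  | cons g l ih =>
    have key : ∀ w, f w ∈ K.map f ↔ w ∈ K := fun w => by
      rw [← Ideal.mem_comap, Ideal.comap_map_of_surjective' f hf, sup_eq_left.2 hK]
    simp only [RegularModulo, List.map_cons]
    rw [ih _ (hK.trans le_sup_left), Ideal.map_sup, Ideal.map_span, Set.image_singleton,
      hf.forall]
    simp only [← map_mul, key]

lemma of_map_of_leftInverse {f : A →+* B} {ρ : B →+* A} (hρ : ρ.comp f = RingHom.id A)
    (l : List A) (K : Ideal A) (h : RegularModulo (K.map f) (l.map f)) : RegularModulo K l := by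
  induction l generalizing K with
  | nil => simp [RegularModulo]
  | cons g l ih =>
    refine ⟨fun w hw => ?_, ih _ ?_⟩
    · have h1 := h.1 (f w) (by rw [← map_mul]; exact Ideal.mem_map_of_mem f hw)
      have h2 := Ideal.mem_map_of_mem ρ h1
      rwa [Ideal.map_map, hρ, Ideal.map_id, ← RingHom.comp_apply, hρ, RingHom.id_apply] at h2
    · rw [Ideal.map_sup, Ideal.map_span, Set.image_singleton]
      exact h.2

end Basic

section Nilpotent

variable {A T : Type*} [CommRing A] [CommRing T]

/-- An ideal-theoretic form of flatness of `T ⧸ K` over `A ⧸ J`. -/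
def FlatModulo (f : A →+* T) (J : Ideal A) (K : Ideal T) : Prop :=
  ∀ (I I' : Ideal A) (r : A), J ≤ I → (∀ x, r * x ∈ I → x ∈ I') →
    ∀ w, f r * w ∈ I.map f ⊔ K → w ∈ I'.map f ⊔ K

/-- Every proper ideal `I` containing `J` has a nonzero class modulo `I` killed by `m`. -/
def HasSocle (J m : Ideal A) : Prop :=
  ∀ I, J ≤ I → I ≠ ⊤ → ∃ s ∉ I, ∀ x ∈ m, s * x ∈ I

lemma hasSocle_of_pow_le {J m : Ideal A} {N : ℕ} (h : m ^ N ≤ J) : HasSocle J m := by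
  classical
  intro I hI hne
  have hex : ∃ t, m ^ t ≤ I := ⟨N, h.trans hI⟩
  have hpos : Nat.find hex ≠ 0 := fun h0 => hne (by
    have := Nat.find_spec hex
    rwa [h0, pow_zero, Ideal.one_eq_top, top_le_iff] at this)
  obtain ⟨t, ht⟩ := Nat.exists_eq_succ_of_ne_zero hpos
  have hlt : ¬ m ^ t ≤ I := Nat.find_min hex (by omega)
  obtain ⟨s, hs, hsI⟩ := SetLike.not_le_iff_exists.1 hlt
  refine ⟨s, hsI, fun x hx => ?_⟩
  have := Nat.find_spec hex
  rw [ht, pow_succ] at this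
  exact this (Ideal.mul_mem_mul hs hx)

variable {f : A →+* T} {J m : Ideal A} {K : Ideal T}

lemma mem_of_mul_mem_of_socle (hm : m.IsMaximal) {I : Ideal A} {s : A} (hs : s ∉ I)
    (hsm : ∀ x ∈ m, s * x ∈ I) (x : A) (hx : s * x ∈ I) : x ∈ m := by
  by_contra hxm
  obtain ⟨y, i, hi, hy⟩ := hm.exists_inv hxm
  apply hs
  have : s = s * x * y + s * i := by linear_combination -s * hy
  rw [this]
  exact I.add_mem (I.mul_mem_right _ hx) (hsm i hi)

lemma map_mul_mem {I : Ideal A} {s : A} (hsm : ∀ x ∈ m, s * x ∈ I) {w : T}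
    (hw : w ∈ m.map f ⊔ K) : f s * w ∈ I.map f ⊔ K := by
  obtain ⟨u, hu, v, hv, rfl⟩ := Submodule.mem_sup.1 hw
  rw [mul_add]
  refine add_mem (Ideal.mem_sup_left ?_) (Ideal.mem_sup_right (K.mul_mem_left _ hv))
  have : Ideal.map f (Ideal.span {s} * m) ≤ I.map f := by
    refine Ideal.map_mono (Ideal.span_singleton_mul_le_iff.2 hsm)
  apply this
  rw [Ideal.map_mul, Ideal.map_span, Set.image_singleton]
  exact Ideal.mul_mem_mul (Ideal.mem_span_singleton_self _) hu

lemma FlatModulo.mem_of_mul_mem_maximal (hF : FlatModulo f J K) (hm : m.IsMaximal)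
    (hs : HasSocle J m) (hJ : J ≠ ⊤) (hJK : J.map f ≤ K) {g : T}
    (hg : ∀ w, g * w ∈ K → w ∈ K) (w : T) (hw : g * w ∈ K ⊔ m.map f) : w ∈ K ⊔ m.map f := by
  obtain ⟨s, hsJ, hsm⟩ := hs J le_rfl hJ
  rw [sup_comm] at hw ⊢
  refine hF J m s le_rfl (mem_of_mul_mem_of_socle hm hsJ hsm) w ?_
  have h := map_mul_mem hsm hw
  rw [sup_eq_right.2 hJK] at h ⊢
  exact hg _ (by rwa [mul_left_comm] at h)

lemma FlatModulo.mem_of_mul_mem [IsNoetherianRing A] (hF : FlatModulo f J K) (hm : m.IsMaximal)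
    (hs : HasSocle J m) {g : T}
    (hg : ∀ w, g * w ∈ K ⊔ m.map f → w ∈ K ⊔ m.map f) (I : Ideal A) (hI : J ≤ I) :
    ∀ w, g * w ∈ I.map f ⊔ K → w ∈ I.map f ⊔ K := by
  induction I using WellFoundedGT.induction with
  | ind I ih =>
    intro z hz
    by_cases hne : I = ⊤
    · subst hne; rw [Ideal.map_top, top_sup_eq]; trivial
    obtain ⟨s, hsI, hsm⟩ := hs I hI hne
    have hlt : I < I ⊔ Ideal.span {s} := by
      refine lt_of_le_of_ne le_sup_left fun h => hsI ?_
      rw [h]; exact Ideal.mem_sup_right (Ideal.mem_span_singleton_self s)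
    have hz' := ih _ hlt (hI.trans le_sup_left) z
      (sup_le_sup_right (Ideal.map_mono le_sup_left) K hz)
    rw [Ideal.map_sup, Ideal.map_span, Set.image_singleton, sup_right_comm] at hz'
    obtain ⟨y, hy, u, hu, rfl⟩ := Submodule.mem_sup.1 hz'
    obtain ⟨w, rfl⟩ := Ideal.mem_span_singleton'.1 hu
    refine add_mem hy ?_
    rw [mul_comm w]
    refine map_mul_mem hsm ?_
    rw [sup_comm]
    refine hg w ?_
    rw [sup_comm]
    refine hF I m s hI (mem_of_mul_mem_of_socle hm hsI hsm) _ ?_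
    have : f s * (g * w) = g * (y + w * f s) - g * y := by ring
    rw [this]
    exact sub_mem hz (Ideal.mul_mem_left _ _ hy)

lemma FlatModulo.sup_span_singleton (hF : FlatModulo f J K) {g : T}
    (hg : ∀ I, J ≤ I → ∀ w, g * w ∈ I.map f ⊔ K → w ∈ I.map f ⊔ K) :
    FlatModulo f J (K ⊔ Ideal.span {g}) := by
  intro I I' r hI hr w hw
  rw [← sup_assoc] at hw ⊢
  obtain ⟨y, hy, u, hu, hyu⟩ := Submodule.mem_sup.1 hw
  obtain ⟨z, rfl⟩ := Ideal.mem_span_singleton'.1 hu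
  have hle : I.map f ⊔ K ≤ (I ⊔ Ideal.span {r}).map f ⊔ K :=
    sup_le_sup_right (Ideal.map_mono le_sup_left) K
  have hz := hg (I ⊔ Ideal.span {r}) (hI.trans le_sup_left) z (by
    have : g * z = f r * w - y := by rw [← hyu]; ring
    rw [this]
    refine sub_mem (Ideal.mul_mem_right _ _ (Ideal.mem_sup_left (Ideal.mem_map_of_mem f
      (Ideal.mem_sup_right (Ideal.mem_span_singleton_self r))))) (hle hy))
  rw [Ideal.map_sup, Ideal.map_span, Set.image_singleton, sup_right_comm] at hz
  obtain ⟨y', hy', u', hu', rfl⟩ := Submodule.mem_sup.1 hz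
  obtain ⟨v, rfl⟩ := Ideal.mem_span_singleton'.1 hu'
  have h := hF I I' r hI hr (w - g * v) (by
    have : f r * (w - g * v) = y + g * y' := by
      rw [mul_sub, ← hyu]; ring
    rw [this]
    exact add_mem hy (Ideal.mul_mem_left _ _ hy'))
  have : w = (w - g * v) + v * g := by ring
  rw [this]
  exact add_mem (Ideal.mem_sup_left h)
    (Ideal.mem_sup_right (Ideal.mem_span_singleton'.2 ⟨v, rfl⟩))

lemma FlatModulo.regularModulo_iff [IsNoetherianRing A] (hF : FlatModulo f J K)
    (hm : m.IsMaximal) (hs : HasSocle J m) (hJ : J ≠ ⊤) (hJK : J.map f ≤ K) (l : List T) :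
    RegularModulo K l ↔ RegularModulo (K ⊔ m.map f) l := by
  induction l generalizing K with
  | nil => simp [RegularModulo]
  | cons g l ih =>
    have h1 : (∀ w, g * w ∈ K → w ∈ K) ↔
        ∀ w, g * w ∈ K ⊔ m.map f → w ∈ K ⊔ m.map f := by
      refine ⟨hF.mem_of_mul_mem_maximal hm hs hJ hJK, fun h => ?_⟩
      have := hF.mem_of_mul_mem hm hs h J le_rfl
      rwa [sup_eq_right.2 hJK] at this
    simp only [RegularModulo]
    rw [h1, sup_right_comm]
    refine and_congr_right fun h => ih ?_ (hJK.trans le_sup_left)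
    exact hF.sup_span_singleton (hF.mem_of_mul_mem hm hs h)

end Nilpotent

section Homogeneous

attribute [local instance] MvPolynomial.gradedAlgebra

variable {σ k : Type*} [CommRing k]

lemma homogeneousComponent_mul_eq_zero {a : MvPolynomial σ k} {D e : ℕ} (ha : a.IsHomogeneous D)
    (h : e < D) (v : MvPolynomial σ k) : homogeneousComponent e (a * v) = 0 := by
  rw [← sum_homogeneousComponent v, Finset.mul_sum, map_sum]
  refine Finset.sum_eq_zero fun i _ => ?_
  rw [homogeneousComponent_of_mem
    ((mem_homogeneousSubmodule _ _).2 (ha.mul (homogeneousComponent_isHomogeneous i v))),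
    if_neg (by omega)]

lemma mem_of_forall_mem_sup_span_pow {K : Ideal (MvPolynomial σ k)}
    (hK : K.IsHomogeneous (homogeneousSubmodule σ k)) {a : MvPolynomial σ k} {d : ℕ} (hd : d ≠ 0)
    (ha : a.IsHomogeneous d) {w : MvPolynomial σ k}
    (h : ∀ N, w ∈ K ⊔ Ideal.span {a ^ N}) : w ∈ K := by
  rw [mem_iff_homogeneousComponent_mem hK]
  intro e
  obtain ⟨y, hy, u, hu, rfl⟩ := Submodule.mem_sup.1 (h (e + 1))
  obtain ⟨v, rfl⟩ := Ideal.mem_span_singleton'.1 hu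
  rw [map_add, mul_comm, homogeneousComponent_mul_eq_zero (ha.pow (e + 1)), add_zero]
  · exact homogeneousComponent_mem_of_mem hK hy e
  · have := Nat.mul_le_mul_right (e + 1) (Nat.one_le_iff_ne_zero.2 hd)
    omega

lemma isHomogeneous_sup_span_singleton {K : Ideal (MvPolynomial σ k)}
    (hK : K.IsHomogeneous (homogeneousSubmodule σ k)) {a : MvPolynomial σ k} {d : ℕ}
    (ha : a.IsHomogeneous d) :
    (K ⊔ Ideal.span {a}).IsHomogeneous (homogeneousSubmodule σ k) := by
  refine hK.sup (Ideal.homogeneous_span _ _ ?_)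
  rintro x rfl
  exact ⟨d, ha⟩

lemma perm {l₁ l₂ : List (MvPolynomial σ k)} (h : l₁.Perm l₂) {d : ℕ} (hd : d ≠ 0)
    (hl : ∀ g ∈ l₁, g.IsHomogeneous d) {K : Ideal (MvPolynomial σ k)}
    (hK : K.IsHomogeneous (homogeneousSubmodule σ k)) (hreg : RegularModulo K l₁) :
    RegularModulo K l₂ := by
  induction h generalizing K with
  | nil => exact hreg
  | cons g _ ih =>
    exact ⟨hreg.1, ih (fun x hx => hl x (List.mem_cons_of_mem _ hx))
      (isHomogeneous_sup_span_singleton hK (hl g List.mem_cons_self)) hreg.2⟩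
  | trans h₁ _ ih₁ ih₂ =>
    exact ih₂ (fun x hx => hl x (h₁.mem_iff.2 hx)) hK (ih₁ hl hK hreg)
  | swap a b l =>
    obtain ⟨hb, ha, hrest⟩ := hreg
    have hbd : b.IsHomogeneous d := hl b (by simp)
    have step : ∀ w, a * w ∈ K → ∃ v, w - b * v ∈ K ∧ a * v ∈ K := by
      intro w hw
      obtain ⟨y, hy, u, hu, rfl⟩ := Submodule.mem_sup.1 (ha w (Ideal.mem_sup_left hw))
      obtain ⟨v, rfl⟩ := Ideal.mem_span_singleton'.1 hu
      refine ⟨v, by convert hy using 1; ring, hb _ ?_⟩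
      have : b * (a * v) = a * (y + v * b) - a * y := by ring
      rw [this]
      exact sub_mem hw (K.mul_mem_left _ hy)
    have hpow : ∀ N w, a * w ∈ K → ∃ v, w - b ^ N * v ∈ K ∧ a * v ∈ K := by
      intro N
      induction N with
      | zero => exact fun w hw => ⟨w, by simp, hw⟩
      | succ N ih =>
        intro w hw
        obtain ⟨v, hv, hav⟩ := ih w hw
        obtain ⟨u, hu, hau⟩ := step v hav
        refine ⟨u, ?_, hau⟩
        have : w - b ^ (N + 1) * u = (w - b ^ N * v) + b ^ N * (v - b * u) := by ring
        rw [this]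
        exact add_mem hv (K.mul_mem_left _ hu)
    refine ⟨fun w hw => mem_of_forall_mem_sup_span_pow hK hd hbd fun N => ?_, fun w hw => ?_, ?_⟩
    · obtain ⟨v, hv, -⟩ := hpow N w hw
      have : w = (w - b ^ N * v) + v * b ^ N := by ring
      rw [this]
      exact add_mem (Ideal.mem_sup_left hv)
        (Ideal.mem_sup_right (Ideal.mem_span_singleton'.2 ⟨v, rfl⟩))
    · obtain ⟨y, hy, u, hu, hyu⟩ := Submodule.mem_sup.1 hw
      obtain ⟨v, rfl⟩ := Ideal.mem_span_singleton'.1 hu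
      have hv := ha v (by
        have : a * v = b * w - y := by rw [← hyu]; ring
        rw [this]
        exact sub_mem (Ideal.mul_mem_right _ _ (Ideal.mem_sup_right
          (Ideal.mem_span_singleton_self b))) (Ideal.mem_sup_left hy))
      obtain ⟨y', hy', u', hu', rfl⟩ := Submodule.mem_sup.1 hv
      obtain ⟨u, rfl⟩ := Ideal.mem_span_singleton'.1 hu'
      have h := hb (w - u * a) (by
        have : b * (w - u * a) = y + a * y' := by linear_combination -hyu
        rw [this]
        exact add_mem hy (K.mul_mem_left _ hy'))
      have : w = (w - u * a) + u * a := by ring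
      rw [this]
      exact add_mem (Ideal.mem_sup_left h)
        (Ideal.mem_sup_right (Ideal.mem_span_singleton'.2 ⟨u, rfl⟩))
    · rwa [sup_right_comm]

end Homogeneous

section Dimension

open RingTheory.Sequence Module

lemma _root_.Module.supportDim_quotient_add_length_le {A M : Type*} [CommRing A]
    [IsNoetherianRing A] [AddCommGroup M] [Module A M] [Module.Finite A M] (rs : List A)
    (h : IsWeaklyRegular M rs) :
    supportDim A (M ⧸ Ideal.ofList rs • (⊤ : Submodule A M)) + rs.length ≤ supportDim A M := by
  induction rs generalizing M with
  | nil =>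
    rw [Ideal.ofList_nil, Submodule.bot_smul]
    simpa using (supportDim_eq_of_equiv (Submodule.quotEquivOfEqBot (⊥ : Submodule A M) rfl)).le
  | cons x rs' ih =>
    rw [isWeaklyRegular_cons_iff] at h
    rw [supportDim_eq_of_equiv (Submodule.quotOfListConsSMulTopEquivQuotSMulTopInner M x rs'),
      List.length_cons, Nat.cast_add, Nat.cast_one, ← add_assoc]
    exact (add_le_add_left (ih h.2) 1).trans
      (supportDim_quotSMulTop_succ_le_of_notMem_minimalPrimes
        fun _ ↦ h.1.notMem_of_mem_minimalPrimes)

lemma _root_.isArtinianRing_quotient_ofList {A : Type*} [CommRing A] [IsNoetherianRing A]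
    (rs : List A) (h : IsWeaklyRegular A rs) (hdim : ringKrullDim A ≤ rs.length) :
    IsArtinianRing (A ⧸ Ideal.ofList rs) := by
  have h1 := (supportDim_quotient_add_length_le rs h).trans
    ((supportDim_self_eq_ringKrullDim A).le.trans hdim)
  rw [smul_eq_mul, Ideal.mul_top, supportDim_quotient_eq_ringKrullDim] at h1
  have : Ring.KrullDimLE 0 (A ⧸ Ideal.ofList rs) := by
    rw [Ring.krullDimLE_iff]
    have h2 : ringKrullDim (A ⧸ Ideal.ofList rs) + (rs.length : WithBot ℕ∞) ≤
        0 + (rs.length : WithBot ℕ∞) := by simpa using h1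
    exact ENat.WithBot.add_le_add_natCast_right_iff.1 h2
  exact IsNoetherianRing.isArtinianRing_of_krullDimLE_zero

end Dimension

end RegularModulo

namespace MvPolynomial

section Supported

variable {σ k : Type*} [Field k] {s : Set σ}

lemma supported_algHom_ext {B : Type*} [Semiring B] [Algebra k B] {φ ψ : supported k s →ₐ[k] B}
    (h : ∀ i (hi : i ∈ s), φ ⟨X i, X_mem_supported.2 hi⟩ = ψ ⟨X i, X_mem_supported.2 hi⟩) :
    φ = ψ := by
  have key : φ.comp (supportedEquivMvPolynomial s).symm.toAlgHom =
      ψ.comp (supportedEquivMvPolynomial s).symm.toAlgHom := by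
    refine algHom_ext fun i => ?_
    have hX : (supportedEquivMvPolynomial s).symm (X i : MvPolynomial s k) =
        ⟨X i.1, X_mem_supported.2 i.2⟩ := Subtype.ext (supportedEquivMvPolynomial_symm_X s i)
    simpa [hX] using h i.1 i.2
  refine AlgHom.ext fun r => ?_
  simpa using DFunLike.congr_fun key (supportedEquivMvPolynomial s r)

instance [Finite σ] : IsNoetherianRing (supported k s) :=
  isNoetherianRing_of_ringEquiv _ (supportedEquivMvPolynomial (R := k) s).symm.toRingEquiv

lemma ringKrullDim_supported [Finite σ] : ringKrullDim (supported k s) = Nat.card s := by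
  rw [ringKrullDim_eq_of_ringEquiv (supportedEquivMvPolynomial (R := k) s).toRingEquiv,
    MvPolynomial.ringKrullDim_of_isNoetherianRing, ringKrullDim_eq_zero_of_field, zero_add]

variable (k s) in
/-- The inclusion of the polynomials supported in `s`, as a ring homomorphism. -/
noncomputable def supportedVal : supported k s →+* MvPolynomial σ k :=
  ((supported k s).val : supported k s →+* MvPolynomial σ k)

@[simp] lemma supportedVal_apply (r : supported k s) :
    supportedVal k s r = (r : MvPolynomial σ k) := rfl

variable (k s) in
open Classical in
/-- The retraction onto the polynomials supported in `s` killing the other variables. -/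
noncomputable def supportedRetract : MvPolynomial σ k →ₐ[k] supported k s :=
  aeval fun i => if hi : i ∈ s then ⟨X i, X_mem_supported.2 hi⟩ else 0

lemma supportedRetract_comp_supportedVal :
    ((supportedRetract k s : MvPolynomial σ k →ₐ[k] supported k s) :
      MvPolynomial σ k →+* supported k s).comp (supportedVal k s) = RingHom.id _ := by
  have : (supportedRetract k s).comp (supported k s).val = AlgHom.id k _ :=
    supported_algHom_ext fun i hi => by simp [supportedRetract, hi]
  exact RingHom.ext fun r => DFunLike.congr_fun this r

lemma mem_map_supportedVal_of_mul_mem {I I' : Ideal (supported k s)} {r : supported k s}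
    (h : ∀ x, r * x ∈ I → x ∈ I') {w : MvPolynomial σ k}
    (hw : supportedVal k s r * w ∈ I.map (supportedVal k s)) :
    w ∈ I'.map (supportedVal k s) := by
  classical
  let e : MvPolynomial σ k →ₐ[k] MvPolynomial σ (supported k s) :=
    aeval fun i => if hi : i ∈ s then C ⟨X i, X_mem_supported.2 hi⟩ else X i
  let v : MvPolynomial σ (supported k s) →+* MvPolynomial σ k := eval₂Hom (supportedVal k s) X
  have hve : ∀ p, v (e p) = p := by
    intro p
    induction p using MvPolynomial.induction_on with
    | C c =>
      simp only [e, v, aeval_C]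
      rw [IsScalarTower.algebraMap_apply k (supported k s) (MvPolynomial σ (supported k s)),
        MvPolynomial.algebraMap_eq, coe_eval₂Hom, eval₂_C]
      rfl
    | add p q hp hq => rw [map_add, map_add, hp, hq]
    | mul_X p i hp =>
      rw [map_mul, map_mul, hp]
      congr 1
      by_cases hi : i ∈ s <;> simp [e, v, hi]
  have heC : ∀ x : supported k s, e (supportedVal k s x) = C x := by
    intro x
    have : e.comp (supported k s).val =
        IsScalarTower.toAlgHom k (supported k s) (MvPolynomial σ (supported k s)) :=
      supported_algHom_ext fun i hi => by simp [e, hi, MvPolynomial.algebraMap_eq]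
    exact DFunLike.congr_fun this x
  have h1 := Ideal.mem_map_of_mem (e : MvPolynomial σ k →+* MvPolynomial σ (supported k s)) hw
  have hcomp : (e : MvPolynomial σ k →+* MvPolynomial σ (supported k s)).comp
      (supportedVal k s) = C := RingHom.ext heC
  rw [Ideal.map_map, hcomp, map_mul] at h1
  have h2 : e w ∈ I'.map (C : supported k s →+* MvPolynomial σ (supported k s)) := by
    rw [mem_map_C_iff] at h1 ⊢
    intro m
    refine h _ ?_
    have := h1 m
    rwa [RingHom.coe_coe, heC, coeff_C_mul] at this
  have h3 := Ideal.mem_map_of_mem v h2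
  have hvC : v.comp C = supportedVal k s := RingHom.ext fun x => by simp [v]
  rwa [Ideal.map_map, hvC, hve] at h3

lemma flatModulo_supportedVal (J : Ideal (supported k s)) :
    RegularModulo.FlatModulo (supportedVal k s) J (J.map (supportedVal k s)) := by
  intro I I' r hI hr w hw
  rw [sup_eq_left.2 (Ideal.map_mono hI)] at hw
  exact Ideal.mem_sup_left (mem_map_supportedVal_of_mul_mem hr hw)

variable (k s) in
/-- The ideal of polynomials supported in `s` without constant term. -/
noncomputable def supportedIrrelevant : Ideal (supported k s) :=
  RingHom.ker ((constantCoeff : MvPolynomial σ k →+* k).comp (supportedVal k s))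

lemma supportedIrrelevant_isMaximal : (supportedIrrelevant k s).IsMaximal := by
  refine RingHom.ker_isMaximal_of_surjective _ fun c => ⟨algebraMap k _ c, ?_⟩
  simp [MvPolynomial.algebraMap_eq]

lemma algHom_eq_algebraMap_constantCoeff {B : Type*} [CommRing B] [Algebra k B]
    (φ : supported k s →ₐ[k] B)
    (h : ∀ i (hi : i ∈ s), φ ⟨X i, X_mem_supported.2 hi⟩ = 0) (r : supported k s) :
    φ r = algebraMap k B (constantCoeff (r : MvPolynomial σ k)) := by
  have : φ = (Algebra.ofId k B).comp
      ((aeval (fun _ => (0 : k)) : MvPolynomial σ k →ₐ[k] k).comp (supported k s).val) :=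
    supported_algHom_ext fun i hi => by simp [h i hi]
  rw [this]
  simp [constantCoeff_eq, Algebra.ofId_apply]

lemma supportedIrrelevant_le {K : Ideal (supported k s)}
    (h : ∀ i (hi : i ∈ s), (⟨X i, X_mem_supported.2 hi⟩ : supported k s) ∈ K) :
    supportedIrrelevant k s ≤ K := by
  intro r hr
  rw [← Ideal.Quotient.eq_zero_iff_mem]
  have := algHom_eq_algebraMap_constantCoeff (B := supported k s ⧸ K)
    (Ideal.Quotient.mkₐ k K)
    (fun i hi => by
      rw [Ideal.Quotient.mkₐ_eq_mk]
      exact Ideal.Quotient.eq_zero_iff_mem.2 (h i hi)) r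
  have hr' : constantCoeff (r : MvPolynomial σ k) = 0 := hr
  rwa [hr', map_zero, Ideal.Quotient.mkₐ_eq_mk] at this

attribute [local instance] MvPolynomial.gradedAlgebra

lemma exists_supportedIrrelevant_pow_le [Finite σ] {J : Ideal (supported k s)}
    (hJ : (J.map (supportedVal k s)).IsHomogeneous (homogeneousSubmodule σ k))
    [IsArtinianRing (supported k s ⧸ J)] : ∃ N, supportedIrrelevant k s ^ N ≤ J := by
  refine Ideal.exists_pow_le_of_le_radical_of_fg (supportedIrrelevant_le fun i hi => ?_)
    (IsNoetherian.noetherian _)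
  set x : supported k s := ⟨X i, X_mem_supported.2 hi⟩ with hx
  obtain ⟨t, y, hy⟩ := IsArtinian.exists_pow_succ_smul_dvd (R := supported k s ⧸ J)
    (M := supported k s ⧸ J) (Ideal.Quotient.mk J x) 1
  obtain ⟨y, rfl⟩ := Ideal.Quotient.mk_surjective y
  have hmem : x ^ (t + 1) * y - x ^ t ∈ J := by
    rw [← Ideal.Quotient.eq_zero_iff_mem]
    simpa [sub_eq_zero] using hy
  refine ⟨t, ?_⟩
  have h1 := homogeneousComponent_mem_of_mem hJ (Ideal.mem_map_of_mem (supportedVal k s) hmem) t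
  have hX : ∀ N, (X i ^ N : MvPolynomial σ k).IsHomogeneous N := fun N => isHomogeneous_X_pow i N
  rw [map_sub, map_mul, map_pow, map_pow, supportedVal_apply, hx, map_sub,
    RegularModulo.homogeneousComponent_mul_eq_zero (hX _) (Nat.lt_succ_self t), zero_sub,
    homogeneousComponent_of_mem ((mem_homogeneousSubmodule _ _).2 (hX t)), if_pos rfl,
    neg_mem_iff] at h1
  have h2 := Ideal.mem_map_of_mem (supportedRetract k s : MvPolynomial σ k →+* supported k s) h1
  rw [Ideal.map_map, supportedRetract_comp_supportedVal, Ideal.map_id] at h2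
  simpa only [RingHom.coe_coe, map_pow, supportedRetract, aeval_X, dif_pos hi] using h2

lemma ofList_ne_top {l : List (MvPolynomial σ k)} {d : ℕ} (hd : d ≠ 0)
    (hl : ∀ g ∈ l, g.IsHomogeneous d) : Ideal.ofList l ≠ ⊤ := by
  have hle : Ideal.ofList l ≤ RingHom.ker (constantCoeff : MvPolynomial σ k →+* k) :=
    Ideal.span_le.2 fun g hg => (hl g hg).coeff_eq_zero (by simpa using hd.symm)
  intro h
  exact RingHom.ker_ne_top _ (top_le_iff.1 (h ▸ hle))

lemma regularModulo_append_comm {l₁ l₂ : List (MvPolynomial σ k)} {d : ℕ} (hd : d ≠ 0)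
    (h₁ : ∀ g ∈ l₁, g.IsHomogeneous d) (h₂ : ∀ g ∈ l₂, g.IsHomogeneous d)
    (h : RegularModulo ⊥ (l₁ ++ l₂)) : RegularModulo ⊥ (l₂ ++ l₁) :=
  RegularModulo.perm List.perm_append_comm hd
    (fun p hp => (List.mem_append.1 hp).elim (h₁ p) (h₂ p)) (Ideal.IsHomogeneous.bot _) h

lemma regularModulo_map_ofList_iff [Finite σ] {L : List (supported k s)} {d : ℕ} (hd : d ≠ 0)
    (hL : ∀ g ∈ L, (g : MvPolynomial σ k).IsHomogeneous d) (hcard : Nat.card s ≤ L.length)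
    (hreg : RegularModulo ⊥ L) (l : List (MvPolynomial σ k)) :
    RegularModulo ((Ideal.ofList L).map (supportedVal k s)) l ↔
      RegularModulo ((supportedIrrelevant k s).map (supportedVal k s)) l := by
  have hle : Ideal.ofList L ≤ supportedIrrelevant k s :=
    Ideal.span_le.2 fun g hg => (hL g hg).coeff_eq_zero (by simpa using hd.symm)
  have hart : IsArtinianRing (supported k s ⧸ Ideal.ofList L) := by
    refine isArtinianRing_quotient_ofList L
      ((RegularModulo.isWeaklyRegular_iff L).2 hreg) ?_
    rw [ringKrullDim_supported]
    exact_mod_cast hcard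
  have hhom : ((Ideal.ofList L).map (supportedVal k s)).IsHomogeneous
      (homogeneousSubmodule σ k) := by
    rw [Ideal.map_ofList]
    refine Ideal.homogeneous_span _ _ fun p hp => ?_
    obtain ⟨q, hq, rfl⟩ := List.mem_map.1 hp
    exact ⟨d, hL q hq⟩
  obtain ⟨N, hN⟩ := exists_supportedIrrelevant_pow_le hhom
  rw [(flatModulo_supportedVal _).regularModulo_iff supportedIrrelevant_isMaximal
    (RegularModulo.hasSocle_of_pow_le hN)
    (ne_top_of_le_ne_top supportedIrrelevant_isMaximal.ne_top hle) le_rfl,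
    sup_eq_right.2 (Ideal.map_mono hle)]

end Supported

end MvPolynomial

namespace MvPolynomial

section Truncation

variable {k : Type*} [Field k] {n a : ℕ}

variable (k n a) in
/-- Setting the variables of index at least `a` to zero. -/
noncomputable def truncation : MvPolynomial (Fin n) k →ₐ[k] MvPolynomial (Fin a) k :=
  aeval fun i : Fin n => if h : (i : ℕ) < a then (X (⟨i, h⟩ : Fin a) : MvPolynomial (Fin a) k) else 0

variable (k n a) in
/-- `truncation`, viewed as an endomorphism of the larger polynomial ring. -/
noncomputable def truncationEnd : MvPolynomial (Fin n) k →ₐ[k] MvPolynomial (Fin n) k :=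
  aeval fun l : Fin n => if (l : ℕ) < a then X l else 0

lemma truncation_isHomogeneous {p : MvPolynomial (Fin n) k} {d : ℕ} (hp : p.IsHomogeneous d) :
    (truncation k n a p).IsHomogeneous d := by
  rw [← one_mul d]
  refine hp.aeval _ fun i => ?_
  split_ifs
  exacts [isHomogeneous_X _ _, isHomogeneous_zero _ _ _]

lemma truncationEnd_isHomogeneous {p : MvPolynomial (Fin n) k} {d : ℕ} (hp : p.IsHomogeneous d) :
    (truncationEnd k n a p).IsHomogeneous d := by
  rw [← one_mul d]
  refine hp.aeval _ fun i => ?_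
  split_ifs
  exacts [isHomogeneous_X _ _, isHomogeneous_zero _ _ _]

lemma truncation_truncationEnd (p : MvPolynomial (Fin n) k) :
    truncation k n a (truncationEnd k n a p) = truncation k n a p := by
  have : (truncation k n a).comp (truncationEnd k n a) = truncation k n a :=
    algHom_ext fun i => by by_cases hi : (i : ℕ) < a <;> simp [truncation, truncationEnd, hi]
  exact DFunLike.congr_fun this p

lemma rename_truncation (h : a ≤ n) (p : MvPolynomial (Fin n) k) :
    rename (Fin.castLE h) (truncation k n a p) = truncationEnd k n a p := by
  have : (rename (Fin.castLE h)).comp (truncation k n a) = truncationEnd k n a :=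
    algHom_ext fun i => by by_cases hi : (i : ℕ) < a <;> simp [truncation, truncationEnd, hi]
  exact DFunLike.congr_fun this p

lemma truncation_surjective (h : a ≤ n) : Function.Surjective (truncation k n a) := by
  have : (truncation k n a).comp (rename (Fin.castLE h)) = AlgHom.id k _ :=
    algHom_ext fun i => by simp [truncation]
  exact fun p => ⟨_, DFunLike.congr_fun this p⟩

lemma X_mem_map_supportedIrrelevant {σ : Type*} {s : Set σ} {i : σ} (hi : i ∈ s) :
    (X i : MvPolynomial σ k) ∈ (supportedIrrelevant k s).map (supportedVal k s) := by
  have h : (⟨X i, X_mem_supported.2 hi⟩ : supported k s) ∈ supportedIrrelevant k s :=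
    constantCoeff_X k i
  exact Ideal.mem_map_of_mem (supportedVal k s) h

lemma sub_truncationEnd_mem (p : MvPolynomial (Fin n) k) :
    p - truncationEnd k n a p ∈
      (supportedIrrelevant k {l : Fin n | a ≤ (l : ℕ)}).map (supportedVal k _) := by
  induction p using MvPolynomial.induction_on with
  | C c =>
    have : truncationEnd k n a (C c) = C c := algHom_C _ c
    rw [this, sub_self]
    exact zero_mem _
  | add p q hp hq =>
    rw [map_add, add_sub_add_comm]
    exact add_mem hp hq
  | mul_X p i hp =>
    rw [map_mul]
    by_cases hi : (i : ℕ) < a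
    · have : truncationEnd k n a (X i) = X i := by simp [truncationEnd, hi]
      rw [this, ← sub_mul]
      exact Ideal.mul_mem_right _ _ hp
    · have : truncationEnd k n a (X i) = 0 := by simp [truncationEnd, hi]
      rw [this, mul_zero, sub_zero]
      exact Ideal.mul_mem_left _ _ (X_mem_map_supportedIrrelevant (not_lt.1 hi))

lemma truncation_eq_algebraMap_constantCoeff (r : supported k {l : Fin n | a ≤ (l : ℕ)}) :
    truncation k n a r =
      algebraMap k (MvPolynomial (Fin a) k) (constantCoeff (r : MvPolynomial (Fin n) k)) :=
  algHom_eq_algebraMap_constantCoeff (B := MvPolynomial (Fin a) k)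
    ((truncation k n a).comp (supported k {l : Fin n | a ≤ (l : ℕ)}).val)
    (fun i (hi : a ≤ (i : ℕ)) => by simp [truncation, not_lt.2 hi]) r

lemma ker_truncation (h : a ≤ n) :
    RingHom.ker (truncation k n a : MvPolynomial (Fin n) k →+* MvPolynomial (Fin a) k) =
      (supportedIrrelevant k {l : Fin n | a ≤ (l : ℕ)}).map (supportedVal k _) := by
  refine le_antisymm (fun p hp => ?_) (Ideal.map_le_iff_le_comap.2 fun r hr => ?_)
  · have hp' : truncation k n a p = 0 := hp
    have := sub_truncationEnd_mem (a := a) p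
    rwa [← rename_truncation h, hp', map_zero, sub_zero] at this
  · have hr' : constantCoeff (r : MvPolynomial (Fin n) k) = 0 := hr
    have := truncation_eq_algebraMap_constantCoeff r
    rw [hr', map_zero] at this
    exact this

lemma regularModulo_map_supportedIrrelevant_iff (h : a ≤ n)
    (l : List (MvPolynomial (Fin n) k)) :
    RegularModulo ((supportedIrrelevant k {l : Fin n | a ≤ (l : ℕ)}).map (supportedVal k _)) l ↔
      RegularModulo ⊥ (l.map (truncation k n a)) := by
  let f : MvPolynomial (Fin n) k →+* MvPolynomial (Fin a) k := truncation k n a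
  have hf : Function.Surjective f := truncation_surjective h
  have hbot : (RingHom.ker f).map f = ⊥ := (Ideal.map_eq_bot_iff_le_ker f).2 le_rfl
  rw [← ker_truncation h]
  exact (RegularModulo.map_iff hf l _ le_rfl).trans (by rw [hbot]; rfl)

end Truncation

end MvPolynomial

lemma Fin.card_setOf_le_val (n a : ℕ) : Nat.card {l : Fin n | a ≤ (l : ℕ)} ≤ n - a := by
  rw [← Nat.card_fin (n - a)]
  exact Nat.card_le_card_of_injective
    (fun l : {l : Fin n | a ≤ (l : ℕ)} => (⟨(l : Fin n) - a, by
      have := l.1.isLt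
      have : a ≤ (l.1 : ℕ) := l.2
      omega⟩ : Fin (n - a)))
    fun l l' h => by
      have h₁ : a ≤ (l.1 : ℕ) := l.2
      have h₂ : a ≤ (l'.1 : ℕ) := l'.2
      have := congrArg Fin.val h
      simp only at this
      exact Subtype.ext (Fin.ext (by omega))

lemma List.ofFn_eq_append {α : Type*} {n a : ℕ} (h : a ≤ n) (f : Fin n → α) :
    List.ofFn f = (List.ofFn fun j : Fin a => f (Fin.castLE h j)) ++
      List.ofFn fun j : Fin (n - a) => f ⟨a + (j : ℕ), by have := j.isLt; omega⟩ := by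
  refine List.ext_getElem (by simp; omega) fun i h₁ h₂ => ?_
  rw [List.getElem_append]
  split_ifs with hi
  · simp
  · simp only [List.length_ofFn] at hi
    simp only [List.getElem_ofFn, List.length_ofFn]
    congr 2
    omega

/-- Proposition 2.6 (first part): if `g_1,…,g_n` is a regular sequence of degree-`d`
forms with `g_{a+1},…,g_n ∈ k[x_{a+1},…,x_n]`, then (i) `g_{a+1},…,g_n` is a regular
sequence in `k[x_{a+1},…,x_n]`; (ii) the truncations `g_i' = g_i(x_1,…,x_a,0,…,0)`,
`i = 1,…,a`, form a regular sequence of degree-`d` forms in `k[x_1,…,x_a]`; and (iii)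
`g_1',…,g_a',g_{a+1},…,g_n` is a regular sequence of degree-`d` forms in `S`, so it
generates a balanced complete intersection ideal of type `(d)^n`. -/
theorem stmt15 {k : Type*} [Field k] [CharZero k] {n d a : ℕ} (hd : 2 ≤ d)
    (ha1 : 1 ≤ a) (ha2 : a ≤ n - 1)
    (g : Fin n → MvPolynomial (Fin n) k)
    (hhom : ∀ i, (g i).IsHomogeneous d)
    (hreg : RingTheory.Sequence.IsRegular (MvPolynomial (Fin n) k) (List.ofFn g))
    (hsupp : ∀ i : Fin n, a ≤ (i : ℕ) → g i ∈ MvPolynomial.supported k {l : Fin n | a ≤ (l : ℕ)}) :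
    RingTheory.Sequence.IsRegular (MvPolynomial.supported k {l : Fin n | a ≤ (l : ℕ)})
      (List.ofFn fun j : Fin (n - a) =>
        (⟨g ⟨a + (j : ℕ), by have := j.isLt; omega⟩,
          hsupp ⟨a + (j : ℕ), by have := j.isLt; omega⟩ (Nat.le_add_right a j)⟩ :
          MvPolynomial.supported k {l : Fin n | a ≤ (l : ℕ)})) ∧
    (∀ j : Fin a,
      ((aeval fun i : Fin n =>
          if h : (i : ℕ) < a then (X (⟨i, h⟩ : Fin a) : MvPolynomial (Fin a) k) else 0)
        (g (Fin.castLE (ha2.trans (Nat.sub_le n 1)) j))).IsHomogeneous d) ∧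
    RingTheory.Sequence.IsRegular (MvPolynomial (Fin a) k)
      (List.ofFn fun j : Fin a =>
        (aeval fun i : Fin n =>
          if h : (i : ℕ) < a then (X (⟨i, h⟩ : Fin a) : MvPolynomial (Fin a) k) else 0)
        (g (Fin.castLE (ha2.trans (Nat.sub_le n 1)) j))) ∧
    (∀ i : Fin n,
      ((if (i : ℕ) < a then
          (aeval fun l : Fin n => if (l : ℕ) < a then X l else 0) (g i)
        else g i) : MvPolynomial (Fin n) k).IsHomogeneous d) ∧
    RingTheory.Sequence.IsRegular (MvPolynomial (Fin n) k)
      (List.ofFn fun i : Fin n =>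
        if (i : ℕ) < a then
          (aeval fun l : Fin n => if (l : ℕ) < a then X l else 0) (g i)
        else g i) := by
  have hd0 : d ≠ 0 := by omega
  have han : a ≤ n := ha2.trans (Nat.sub_le n 1)
  set s : Set (Fin n) := {l : Fin n | a ≤ (l : ℕ)} with hs
  set L : List (supported k s) := List.ofFn fun j : Fin (n - a) =>
    ⟨g ⟨a + (j : ℕ), by have := j.isLt; omega⟩,
      hsupp ⟨a + (j : ℕ), by have := j.isLt; omega⟩ (Nat.le_add_right a j)⟩ with hL
  set L₁ : List (MvPolynomial (Fin n) k) := List.ofFn fun j : Fin a => g (Fin.castLE han j)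
    with hL₁
  set L₂ : List (MvPolynomial (Fin n) k) := List.ofFn fun j : Fin (n - a) =>
    g ⟨a + (j : ℕ), by have := j.isLt; omega⟩ with hL₂
  have hLL₂ : L.map (supportedVal k s) = L₂ := by
    rw [hL, hL₂, List.map_ofFn]; rfl
  have hom₁ : ∀ p ∈ L₁, p.IsHomogeneous d := by
    rw [hL₁, List.forall_mem_ofFn_iff]; exact fun _ => hhom _
  have hom₂ : ∀ p ∈ L₂, p.IsHomogeneous d := by
    rw [hL₂, List.forall_mem_ofFn_iff]; exact fun _ => hhom _
  have hJ : (Ideal.ofList L).map (supportedVal k s) = Ideal.ofList L₂ := by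
    rw [Ideal.map_ofList, hLL₂]
  have hreg₂₁ : RegularModulo ⊥ (L₂ ++ L₁) := by
    have h := ((RegularModulo.isRegular_iff _).1 hreg).1
    rw [List.ofFn_eq_append han] at h
    exact regularModulo_append_comm hd0 hom₁ hom₂ h
  obtain ⟨hreg₂, hreg₁⟩ := (RegularModulo.append_iff _ _ _).1 hreg₂₁
  rw [bot_sup_eq, ← hJ] at hreg₁
  have hregL : RegularModulo ⊥ L := by
    refine RegularModulo.of_map_of_leftInverse supportedRetract_comp_supportedVal L ⊥ ?_
    rwa [Ideal.map_bot, hLL₂]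
  have hJtop : Ideal.ofList L ≠ ⊤ := fun h =>
    ofList_ne_top hd0 hom₂ (by rw [← hJ, h, Ideal.map_top])
  have hiff : ∀ l, RegularModulo ((Ideal.ofList L).map (supportedVal k s)) l ↔
      RegularModulo ⊥ (l.map (truncation k n a)) := fun l =>
    (regularModulo_map_ofList_iff hd0
      (fun p hp => hom₂ p (hLL₂ ▸ List.mem_map_of_mem (f := supportedVal k s) hp))
      (by rw [hL, List.length_ofFn]; exact Fin.card_setOf_le_val n a) hregL l).trans
      (regularModulo_map_supportedIrrelevant_iff han l)
  have hregT : RegularModulo ⊥ (L₁.map (truncation k n a)) := (hiff _).1 hreg₁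
  have hregE : RegularModulo (Ideal.ofList L₂) (L₁.map (truncationEnd k n a)) := by
    rw [← hJ, hiff, List.map_map]
    convert hregT using 2
    exact funext truncation_truncationEnd
  have homE : ∀ i : Fin n, ((if (i : ℕ) < a then truncationEnd k n a (g i) else g i) :
      MvPolynomial (Fin n) k).IsHomogeneous d := by
    intro i
    split_ifs
    exacts [truncationEnd_isHomogeneous (hhom i), hhom i]
  refine ⟨(RegularModulo.isRegular_iff _).2 ⟨hregL, hJtop⟩,
    fun j => truncation_isHomogeneous (hhom _),
    (RegularModulo.isRegular_iff _).2 ⟨?_, ofList_ne_top hd0 ?_⟩, homE,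
    (RegularModulo.isRegular_iff _).2 ⟨?_, ofList_ne_top hd0 ?_⟩⟩
  · rw [hL₁, List.map_ofFn] at hregT
    exact hregT
  · rw [List.forall_mem_ofFn_iff]
    exact fun j => truncation_isHomogeneous (hhom _)
  · rw [List.ofFn_eq_append han]
    have h₁ : RegularModulo ⊥ (L₁.map (truncationEnd k n a) ++ L₂) := by
      refine regularModulo_append_comm hd0 hom₂ (fun p hp => ?_)
        ((RegularModulo.append_iff _ _ _).2 ⟨hreg₂, by rwa [bot_sup_eq]⟩)
      obtain ⟨q, hq, rfl⟩ := List.mem_map.1 hp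
      exact truncationEnd_isHomogeneous (hom₁ q hq)
    convert h₁ using 2
    · rw [hL₁, List.map_ofFn]
      congr 1
      funext j
      simp [truncationEnd]
    · rw [hL₂]
      congr 1
      funext j
      simp
  · rw [List.forall_mem_ofFn_iff]
    exact homE
end

section
/- Let 1 ≤ a ≤ n−1 and d ≥ 2. Suppose g_1,…,g_a ∈ k[x_1,…,x_a] is a regular sequence of homogeneous forms of degree d and g_{a+1},…,g_n ∈ k[x_{a+1},…,x_n] is a regular sequence of homogeneous forms of degree d. Suppose F ∈ D is homogeneous of degree n(d−1) with g ∘ F = 0 for every homogeneous g ∈ (g_1,…,g_n) of degree n(d−1) and det Jac(g_1,…,g_n) ∘ F = (n(d−1))!; suppose F_1 ∈ k[z_1,…,z_a] is homogeneous of degree a(d−1) with g ∘ F_1 = 0 for every homogeneous g ∈ (g_1,…,g_a) ⊆ k[x_1,…,x_a] of degree a(d−1) and det Jac(g_1,…,g_a) ∘ F_1 = (a(d−1))! (Jacobian with respect to x_1,…,x_a); and suppose F_2 ∈ k[z_{a+1},…,z_n] is homogeneous of degree (n−a)(d−1) with g ∘ F_2 = 0 for every homogeneous g ∈ (g_{a+1},…,g_n)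 ⊆ k[x_{a+1},…,x_n] of degree (n−a)(d−1) and det Jac(g_{a+1},…,g_n) ∘ F_2 = ((n−a)(d−1))! (Jacobian with respect to x_{a+1},…,x_n). Then F = C(n(d−1), a(d−1)) · F_1 · F_2, where C(n(d−1), a(d−1)) is the binomial coefficient. -/
open MvPolynomial

/-- The operator `∂^m = ∏ᵢ (∂/∂zᵢ)^{mᵢ}` on `k[z_1,…,z_n]`. -/
noncomputable def monDiff (k : Type*) [CommRing k] {n : ℕ} (m : Fin n →₀ ℕ) :
    Module.End k (MvPolynomial (Fin n) k) :=
  (List.ofFn fun i : Fin n =>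
    ((MvPolynomial.pderiv i).toLinearMap : Module.End k (MvPolynomial (Fin n) k)) ^ (m i)).prod

/-- The apolarity action: `apolar g f = g(∂/∂z_1,…,∂/∂z_n) f`. -/
noncomputable def apolar {k : Type*} [CommRing k] {n : ℕ}
    (g f : MvPolynomial (Fin n) k) : MvPolynomial (Fin n) k :=
  ∑ m ∈ g.support, g.coeff m • (monDiff k m f)

/-- The Hilbert function of the quotient of a graded algebra by an ideal. -/
noncomputable def quotientHilbert (k : Type*) {A : Type*} [Field k] [CommRing A] [Algebra k A]
    (𝒜 : ℕ → Submodule k A) (I : Ideal A) (e : ℕ) : ℕ :=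
  Module.finrank k ((𝒜 e).map (Ideal.Quotient.mkₐ k I).toLinearMap)

section Hilbert

variable {k A : Type*} [Field k] [CommRing A] [Algebra k A] (𝒜 : ℕ → Submodule k A)

theorem finrank_map_mkₐ_add_finrank_inf (I : Ideal A) (V : Submodule k A) [FiniteDimensional k V] :
    Module.finrank k (V.map (Ideal.Quotient.mkₐ k I).toLinearMap) +
      Module.finrank k (V ⊓ I.restrictScalars k : Submodule k A) = Module.finrank k V := by
  have h := ((Ideal.Quotient.mkₐ k I).toLinearMap.domRestrict V).finrank_range_add_finrank_ker
  rw [LinearMap.range_domRestrict] at h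
  rw [← h, LinearMap.ker_domRestrict]
  congr 1
  have hk : (Ideal.Quotient.mkₐ k I).toLinearMap.ker = I.restrictScalars k := by
    ext x; simp [Ideal.Quotient.eq_zero_iff_mem]
  rw [hk, ← Submodule.finrank_map_subtype_eq, Submodule.map_comap_subtype]

variable [GradedAlgebra 𝒜]

theorem exists_graded_add_mul_of_mem_sup_span {I : Ideal A} (hI : I.IsHomogeneous 𝒜) {d e : ℕ} {g : A}
    (hg : g ∈ 𝒜 d) {p : A} (hp : p ∈ 𝒜 e) (hmem : p ∈ I ⊔ Ideal.span {g}) :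
    ∃ y ∈ I, y ∈ 𝒜 e ∧ ∃ x, (d ≤ e → x ∈ 𝒜 (e - d)) ∧ (e < d → x = 0) ∧ p = y + g * x := by
  obtain ⟨y, hy, z, hz, rfl⟩ := Submodule.mem_sup.1 hmem
  obtain ⟨x, rfl⟩ := Ideal.mem_span_singleton'.1 hz
  have h := DirectSum.decompose_of_mem_same 𝒜 hp
  rw [DirectSum.decompose_add, DirectSum.add_apply, Submodule.coe_add,
    DirectSum.coe_decompose_mul_of_right_mem 𝒜 e hg] at h
  refine ⟨DirectSum.decompose 𝒜 y e, hI e hy, SetLike.coe_mem _,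
    if d ≤ e then DirectSum.decompose 𝒜 x (e - d) else 0, fun h => ?_, fun h => ?_, ?_⟩
  · rw [if_pos h]; exact SetLike.coe_mem _
  · rw [if_neg (not_le.2 h)]
  · rw [← h]; split_ifs <;> simp [mul_comm]

variable [∀ e, FiniteDimensional k (𝒜 e)]

theorem quotientHilbert_sup_span_of_lt {I : Ideal A} (hI : I.IsHomogeneous 𝒜) {d e : ℕ} {g : A}
    (hg : g ∈ 𝒜 d) (hde : e < d) :
    quotientHilbert k 𝒜 (I ⊔ Ideal.span {g}) e = quotientHilbert k 𝒜 I e := by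
  have h1 := finrank_map_mkₐ_add_finrank_inf I (𝒜 e)
  have h2 := finrank_map_mkₐ_add_finrank_inf (I ⊔ Ideal.span {g}) (𝒜 e)
  have h3 : (𝒜 e ⊓ (I ⊔ Ideal.span {g}).restrictScalars k : Submodule k A) =
      𝒜 e ⊓ I.restrictScalars k := by
    ext p
    refine ⟨fun ⟨hp, hm⟩ => ⟨hp, ?_⟩, fun ⟨hp, hm⟩ => ⟨hp, Ideal.mem_sup_left hm⟩⟩
    obtain ⟨y, hy, -, x, -, hx, rfl⟩ := exists_graded_add_mul_of_mem_sup_span 𝒜 hI hg hp hm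
    simpa [hx hde] using hy
  rw [h3] at h2
  unfold quotientHilbert
  omega

theorem quotientHilbert_sup_span_add {I : Ideal A} (hI : I.IsHomogeneous 𝒜) {d e : ℕ} {g : A}
    (hg : g ∈ 𝒜 d) (hreg : ∀ x, g * x ∈ I → x ∈ I) :
    quotientHilbert k 𝒜 (I ⊔ Ideal.span {g}) (e + d) + quotientHilbert k 𝒜 I e =
      quotientHilbert k 𝒜 I (e + d) := by
  have h1 := finrank_map_mkₐ_add_finrank_inf I (𝒜 (e + d))
  have h2 := finrank_map_mkₐ_add_finrank_inf (I ⊔ Ideal.span {g}) (𝒜 (e + d))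
  set V : Submodule k A := 𝒜 (e + d) ⊓ (I ⊔ Ideal.span {g}).restrictScalars k with hV
  have : FiniteDimensional k V := Submodule.finiteDimensional_of_le (inf_le_left : V ≤ 𝒜 (e + d))
  have h3 := finrank_map_mkₐ_add_finrank_inf I V
  have h4 : V ⊓ I.restrictScalars k = 𝒜 (e + d) ⊓ I.restrictScalars k := by
    ext p
    exact ⟨fun ⟨⟨hp, _⟩, hm⟩ => ⟨hp, hm⟩, fun ⟨hp, hm⟩ => ⟨⟨hp, Ideal.mem_sup_left hm⟩, hm⟩⟩
  have h5 : V.map (Ideal.Quotient.mkₐ k I).toLinearMap =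
      ((𝒜 e).map (Ideal.Quotient.mkₐ k I).toLinearMap).map
        (LinearMap.mulLeft k (Ideal.Quotient.mkₐ k I g)) := by
    ext q
    constructor
    · rintro ⟨p, ⟨hp, hm⟩, rfl⟩
      obtain ⟨y, hy, -, x, hx, -, rfl⟩ := exists_graded_add_mul_of_mem_sup_span 𝒜 hI hg hp hm
      refine ⟨_, ⟨x, by simpa using hx (Nat.le_add_left d e), rfl⟩, ?_⟩
      simp [Ideal.Quotient.eq_zero_iff_mem.2 hy]
    · rintro ⟨_, ⟨x, hx, rfl⟩, rfl⟩
      refine ⟨g * x, ⟨?_, ?_⟩, by simp⟩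
      · rw [add_comm e d]; exact SetLike.mul_mem_graded hg hx
      · exact Ideal.mem_sup_right (Ideal.mul_mem_right _ _ (Ideal.mem_span_singleton_self g))
  have h6 : Function.Injective (LinearMap.mulLeft k (Ideal.Quotient.mkₐ k I g)) := by
    rw [injective_iff_map_eq_zero]
    intro x hx
    obtain ⟨x, rfl⟩ := Ideal.Quotient.mk_surjective x
    rw [Ideal.Quotient.eq_zero_iff_mem]
    apply hreg
    rw [← Ideal.Quotient.eq_zero_iff_mem, map_mul]
    exact hx
  rw [h4, h5, ← (Submodule.equivMapOfInjective _ h6 _).finrank_eq] at h3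
  unfold quotientHilbert
  omega

theorem mk_quotientHilbert_ofList {d : ℕ} (rs : List A) (hd : ∀ r ∈ rs, r ∈ 𝒜 d)
    (hreg : RingTheory.Sequence.IsWeaklyRegular A rs) :
    (PowerSeries.mk fun e => (quotientHilbert k 𝒜 (Ideal.ofList rs) e : ℤ)) =
      (1 - PowerSeries.X ^ d) ^ rs.length *
        PowerSeries.mk fun e => (quotientHilbert k 𝒜 ⊥ e : ℤ) := by
  induction rs using List.reverseRecOn with
  | nil => simp
  | append_singleton rs g ih =>
    rw [RingTheory.Sequence.isWeaklyRegular_append_iff,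
      RingTheory.Sequence.isWeaklyRegular_singleton_iff] at hreg
    have hI : (Ideal.ofList rs).IsHomogeneous 𝒜 :=
      Ideal.homogeneous_span 𝒜 _ fun x hx => ⟨d, hd x (by simpa using Or.inl hx)⟩
    have hg : g ∈ 𝒜 d := hd g (by simp)
    have hg' : ∀ x, g * x ∈ Ideal.ofList rs → x ∈ Ideal.ofList rs := by
      intro x hx
      have h := hreg.2 (a₁ := Submodule.Quotient.mk x) (a₂ := 0)
      simp only [smul_zero, ← Submodule.Quotient.mk_smul, Submodule.Quotient.mk_eq_zero,
        smul_eq_mul, Ideal.mul_top] at h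
      exact h hx
    rw [List.length_append, List.length_singleton, pow_succ', mul_assoc,
      ← ih (fun r hr => hd r (by simp [hr])) hreg.1, Ideal.ofList_append, Ideal.ofList_singleton,
      sub_mul, one_mul]
    ext e
    rw [map_sub, PowerSeries.coeff_X_pow_mul', PowerSeries.coeff_mk, PowerSeries.coeff_mk]
    split_ifs with hde
    · obtain ⟨e, rfl⟩ := Nat.exists_eq_add_of_le' hde
      have := quotientHilbert_sup_span_add 𝒜 hI hg hg' (e := e)
      rw [Nat.add_sub_cancel, PowerSeries.coeff_mk]
      omega
    · rw [quotientHilbert_sup_span_of_lt 𝒜 hI hg (not_le.1 hde), sub_zero]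

end Hilbert

section PolynomialRing

attribute [local instance] MvPolynomial.gradedAlgebra

instance finiteDimensional_homogeneousSubmodule (σ k : Type*) [Finite σ] [Field k] (e : ℕ) :
    FiniteDimensional k (homogeneousSubmodule σ k e) :=
  Module.Finite.iff_fg.2 (homogeneousSubmodule_fg σ k e)

theorem finrank_homogeneousSubmodule (σ k : Type*) [Fintype σ] [Field k] (e : ℕ) :
    Module.finrank k (homogeneousSubmodule σ k e) = (Fintype.card σ).multichoose e := by
  classical
  have h : {d : σ →₀ ℕ | d.degree = e} = (Finset.univ.finsuppAntidiag e : Finset (σ →₀ ℕ)) := by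
    ext v
    simp [Finsupp.degree_eq_sum]
  rw [homogeneousSubmodule_eq_finsupp_supported]
  refine (Module.finrank_eq_nat_card_basis (basisRestrictSupport k {d | d.degree = e})).trans ?_
  rw [h, ← Finset.card_univ, ← Finset.card_finsuppAntidiag_nat_eq_multichoose]
  exact (Nat.card_coe_set_eq _).trans (Set.ncard_coe_finset _)

theorem mk_quotientHilbert_bot_mul (σ k : Type*) [Fintype σ] [Field k] :
    (PowerSeries.mk fun e => (quotientHilbert k (homogeneousSubmodule σ k) ⊥ e : ℤ)) *
      (1 - PowerSeries.X) ^ Fintype.card σ = 1 := by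
  have h (e : ℕ) : quotientHilbert k (homogeneousSubmodule σ k) ⊥ e =
      (Fintype.card σ).multichoose e := by
    have h := finrank_map_mkₐ_add_finrank_inf (k := k) ⊥ (homogeneousSubmodule σ k e)
    have h0 : ((⊥ : Ideal (MvPolynomial σ k)).restrictScalars k) = ⊥ := rfl
    rw [h0, inf_bot_eq, finrank_bot, add_zero, finrank_homogeneousSubmodule] at h
    exact h
  simp_rw [h]
  rcases Fintype.card σ with _ | m
  · ext e
    rcases e with _ | e <;> simp [PowerSeries.coeff_one]
  · refine Eq.trans ?_ (PowerSeries.mk_add_choose_mul_one_sub_pow_eq_one ℤ m)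
    congr 1
    ext e
    rw [PowerSeries.coeff_mk, PowerSeries.coeff_mk, Nat.multichoose_eq, show m + 1 + e - 1 = m + e by omega, Nat.choose_symm_add]

theorem mk_quotientHilbert_completeIntersection {σ k : Type*} [Fintype σ] [Field k] {d : ℕ}
    (rs : List (MvPolynomial σ k)) (hlen : rs.length = Fintype.card σ)
    (hd : ∀ r ∈ rs, r.IsHomogeneous d)
    (hreg : RingTheory.Sequence.IsWeaklyRegular (MvPolynomial σ k) rs) :
    (PowerSeries.mk fun e =>
      (quotientHilbert k (homogeneousSubmodule σ k) (Ideal.ofList rs) e : ℤ)) =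
      (((∑ i ∈ Finset.range d, Polynomial.X ^ i) ^ Fintype.card σ : Polynomial ℤ) :
        PowerSeries ℤ) := by
  rw [mk_quotientHilbert_ofList (homogeneousSubmodule σ k) rs hd hreg, hlen]
  have h : (1 - PowerSeries.X ^ d : PowerSeries ℤ) =
      ((∑ i ∈ Finset.range d, Polynomial.X ^ i : Polynomial ℤ) : PowerSeries ℤ) *
        (1 - PowerSeries.X) := by
    have := geom_sum_mul_neg (Polynomial.X : Polynomial ℤ) d
    simpa using (congrArg (Polynomial.toPowerSeries) this).symm
  rw [h, mul_pow, mul_assoc, mul_comm (_ ^ _) (PowerSeries.mk _), mk_quotientHilbert_bot_mul,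
    mul_one, Polynomial.coe_pow]

theorem quotientHilbert_socle {σ k : Type*} [Fintype σ] [Field k] {d : ℕ} (hd0 : 1 ≤ d)
    (rs : List (MvPolynomial σ k)) (hlen : rs.length = Fintype.card σ)
    (hd : ∀ r ∈ rs, r.IsHomogeneous d)
    (hreg : RingTheory.Sequence.IsWeaklyRegular (MvPolynomial σ k) rs) :
    quotientHilbert k (homogeneousSubmodule σ k) (Ideal.ofList rs)
        (Fintype.card σ * (d - 1)) = 1 ∧
      ∀ e, Fintype.card σ * (d - 1) < e →
        quotientHilbert k (homogeneousSubmodule σ k) (Ideal.ofList rs) e = 0 := by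
  have h := mk_quotientHilbert_completeIntersection rs hlen hd hreg
  have hc (e : ℕ) := congrArg (PowerSeries.coeff e) h
  simp only [PowerSeries.coeff_mk, Polynomial.coeff_coe] at hc
  have hm : (∑ i ∈ Finset.range d, Polynomial.X ^ i : Polynomial ℤ).Monic :=
    Polynomial.monic_geom_sum_X (by omega)
  have hdeg : (∑ i ∈ Finset.range d, Polynomial.X ^ i : Polynomial ℤ).natDegree = d - 1 := by
    have h1 := congrArg Polynomial.natDegree (geom_sum_mul (Polynomial.X : Polynomial ℤ) d)
    have h2 : (Polynomial.X - 1 : Polynomial ℤ).natDegree = 1 := Polynomial.natDegree_X_sub_C 1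
    have h3 : (Polynomial.X ^ d - 1 : Polynomial ℤ).natDegree = d :=
      Polynomial.natDegree_X_pow_sub_C (r := 1)
    rw [hm.natDegree_mul (q := Polynomial.X - 1) (Polynomial.monic_X_sub_C 1), h2, h3] at h1
    omega
  have hdeg' := hm.natDegree_pow (Fintype.card σ)
  rw [hdeg] at hdeg'
  constructor
  · have := (hm.pow (Fintype.card σ)).coeff_natDegree
    rw [hdeg', ← hc] at this
    exact_mod_cast this
  · intro e he
    have := Polynomial.coeff_eq_zero_of_natDegree_lt (hdeg'.trans_lt he)
    rw [← hc] at this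
    exact_mod_cast this

theorem socle_of_completeIntersection {σ k : Type*} [Fintype σ] [Field k] {d : ℕ} (hd0 : 1 ≤ d)
    (rs : List (MvPolynomial σ k)) (hlen : rs.length = Fintype.card σ)
    (hd : ∀ r ∈ rs, r.IsHomogeneous d)
    (hreg : RingTheory.Sequence.IsWeaklyRegular (MvPolynomial σ k) rs) :
    (∀ p e, p.IsHomogeneous e → Fintype.card σ * (d - 1) < e → p ∈ Ideal.ofList rs) ∧
      ∀ p j, p.IsHomogeneous (Fintype.card σ * (d - 1)) →
        j.IsHomogeneous (Fintype.card σ * (d - 1)) → j ∉ Ideal.ofList rs →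
        ∃ c : k, p - c • j ∈ Ideal.ofList rs := by
  obtain ⟨h1, h2⟩ := quotientHilbert_socle hd0 rs hlen hd hreg
  constructor
  · intro p e hp he
    have h := h2 e he
    rw [quotientHilbert, Submodule.finrank_eq_zero] at h
    have := Submodule.mem_map_of_mem (f := (Ideal.Quotient.mkₐ k (Ideal.ofList rs)).toLinearMap)
      ((mem_homogeneousSubmodule e p).2 hp)
    rw [h] at this
    exact Ideal.Quotient.eq_zero_iff_mem.1 this
  · intro p j hp hj hjI
    have mem (q) (hq : q.IsHomogeneous (Fintype.card σ * (d - 1))) :=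
      Submodule.mem_map_of_mem (f := (Ideal.Quotient.mkₐ k (Ideal.ofList rs)).toLinearMap)
      ((mem_homogeneousSubmodule _ q).2 hq)
    obtain ⟨c, hc⟩ := exists_smul_eq_of_finrank_eq_one h1 (x := ⟨_, mem j hj⟩)
      (fun h => hjI (Ideal.Quotient.eq_zero_iff_mem.1 (congrArg Subtype.val h))) ⟨_, mem p hp⟩
    refine ⟨c, Ideal.Quotient.eq_zero_iff_mem.1 ?_⟩
    have hc' := congrArg Subtype.val hc
    change c • (Ideal.Quotient.mkₐ k (Ideal.ofList rs) j) = Ideal.Quotient.mkₐ k (Ideal.ofList rs) p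
      at hc'
    change Ideal.Quotient.mkₐ k (Ideal.ofList rs) _ = 0
    rw [map_sub, map_smul, hc', sub_self]

end PolynomialRing

section Supported

variable {k : Type*} [Field k] {n : ℕ}

theorem rename_supportedEquivMvPolynomial (s : Set (Fin n)) (p : supported k s) :
    rename (↑) (supportedEquivMvPolynomial s p) = (p : MvPolynomial (Fin n) k) := by
  obtain ⟨q, rfl⟩ := (supportedEquivMvPolynomial s).symm.surjective p
  rw [AlgEquiv.apply_symm_apply]
  rfl

theorem socle_of_completeIntersection_supported (s : Set (Fin n)) {m d : ℕ} (hm : Nat.card s = m)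
    (hd0 : 1 ≤ d) (G : Fin m → supported k s)
    (hG : ∀ j, (G j : MvPolynomial (Fin n) k).IsHomogeneous d)
    (hreg : RingTheory.Sequence.IsWeaklyRegular (supported k s) (List.ofFn G)) :
    (∀ (p : supported k s) (e : ℕ), (p : MvPolynomial (Fin n) k).IsHomogeneous e →
        m * (d - 1) < e → p ∈ Ideal.span (Set.range G)) ∧
      ∀ p j : supported k s, (p : MvPolynomial (Fin n) k).IsHomogeneous (m * (d - 1)) →
        (j : MvPolynomial (Fin n) k).IsHomogeneous (m * (d - 1)) →
        j ∉ Ideal.span (Set.range G) → ∃ c : k, p - c • j ∈ Ideal.span (Set.range G) := by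
  classical
  have : Fintype s := Fintype.ofFinite s
  rw [Nat.card_eq_fintype_card] at hm
  let E := supportedEquivMvPolynomial (R := k) s
  have hhom (p : supported k s) (e : ℕ) (hp : (p : MvPolynomial (Fin n) k).IsHomogeneous e) :
      (E p).IsHomogeneous e := by
    rw [← rename_supportedEquivMvPolynomial] at hp
    exact (IsHomogeneous.rename_isHomogeneous_iff Subtype.val_injective).1 hp
  have hmem (p : supported k s) :
      E p ∈ Ideal.ofList ((List.ofFn G).map E) ↔ p ∈ Ideal.span (Set.range G) := by
    have h1 : Ideal.span (Set.range G) = Ideal.ofList (List.ofFn G) := by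
      simp [Ideal.ofList, Set.range, List.mem_ofFn']
    have h2 : Ideal.ofList ((List.ofFn G).map E) =
        (Ideal.ofList (List.ofFn G)).map (E : supported k s ≃+* MvPolynomial s k) :=
      (Ideal.map_ofList (E : supported k s ≃+* MvPolynomial s k).toRingHom _).symm
    rw [h1, h2]
    exact Ideal.apply_mem_of_equiv_iff (f := (E : supported k s ≃+* MvPolynomial s k))
  have hreg' : RingTheory.Sequence.IsWeaklyRegular (MvPolynomial s k) ((List.ofFn G).map E) := by
    refine (AddEquiv.isWeaklyRegular_congr (e := E.toRingEquiv.toAddEquiv) ?_).1 hreg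
    exact List.forall₂_map_right_iff.mpr <| List.forall₂_same.mpr fun r _ x => map_mul E r x
  obtain ⟨h1, h2⟩ := socle_of_completeIntersection hd0 ((List.ofFn G).map E) (by simp [hm])
    (by
      intro r hr
      obtain ⟨q, hq, rfl⟩ := List.mem_map.1 hr
      obtain ⟨j, rfl⟩ := (List.mem_ofFn' G q).1 hq
      exact hhom _ _ (hG j)) hreg'
  rw [hm] at h1 h2
  refine ⟨fun p e hp he => (hmem p).1 (h1 _ _ (hhom p e hp) he), fun p j hp hj hjI => ?_⟩
  obtain ⟨c, hc⟩ := h2 (E p) (E j) (hhom _ _ hp) (hhom _ _ hj) fun h => hjI ((hmem j).1 h)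
  exact ⟨c, (hmem _).1 (by rwa [map_sub, map_smul])⟩

theorem supported_induction {s : Set (Fin n)} {P : MvPolynomial (Fin n) k → Prop}
    (zero : P 0) (add : ∀ p q, P p → P q → P (p + q))
    (monomial : ∀ (m : Fin n →₀ ℕ) (c : k), (∀ i ∉ s, m i = 0) → P (monomial m c))
    {p : MvPolynomial (Fin n) k} (hp : p ∈ supported k s) : P p := by
  rw [p.as_sum]
  refine Finset.sum_induction _ P add zero fun m hm => monomial m _ fun i hi => ?_
  by_contra hmi
  exact hi (mem_supported.1 hp ((mem_vars_iff_mem_support i).2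
    ⟨m, hm, Finsupp.mem_support_iff.2 hmi⟩))

theorem pderiv_mem_supported {s : Set (Fin n)} {p : MvPolynomial (Fin n) k}
    (hp : p ∈ supported k s) (i : Fin n) : pderiv i p ∈ supported k s := by
  refine supported_induction (P := fun p => pderiv i p ∈ supported k s) ?_ ?_ ?_ hp
  · simp
  · intro p q hp hq
    rw [map_add]
    exact add_mem hp hq
  · intro m c hm
    rw [pderiv_monomial, mem_supported]
    intro j hj
    by_contra hjs
    obtain ⟨v, hv, hjv⟩ := (mem_vars_iff_mem_support j).1 hj
    have := support_monomial_subset hv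
    rw [Finset.mem_singleton] at this
    subst this
    simp [hm j hjs] at hjv

end Supported

theorem det_mem_subalgebra {R A : Type*} [CommRing R] [CommRing A] [Algebra R A]
    (S : Subalgebra R A) {m : ℕ} (M : Matrix (Fin m) (Fin m) A) (hM : ∀ i j, M i j ∈ S) :
    M.det ∈ S := by
  rw [Matrix.det_apply]
  exact sum_mem fun σ _ => zsmul_mem (prod_mem fun i _ => hM _ _) _

theorem isHomogeneous_det {k : Type*} [CommRing k] {σ : Type*} {m e : ℕ}
    (M : Matrix (Fin m) (Fin m) (MvPolynomial σ k)) (hM : ∀ i j, (M i j).IsHomogeneous e) :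
    M.det.IsHomogeneous (m * e) := by
  rw [Matrix.det_apply]
  refine IsHomogeneous.sum _ _ _ fun σ _ => (homogeneousSubmodule _ k (m * e)).smul_of_tower_mem _ ?_
  have := IsHomogeneous.prod Finset.univ (fun i => M (σ i) i) (fun _ => e) fun i _ => hM _ _
  simpa using this

section Pairing

variable {k : Type*} [Field k] {n : ℕ}

/-- The pairing given by the constant coefficient of the apolarity action. -/
noncomputable def apolarPairing (k : Type*) [Field k] (n : ℕ) :
    MvPolynomial (Fin n) k →ₗ[k] MvPolynomial (Fin n) k →ₗ[k] k :=
  (basisMonomials (Fin n) k).constr k fun m => (∏ i, ((m i).factorial : k)) • lcoeff k m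

theorem apolarPairing_monomial (m : Fin n →₀ ℕ) (c : k) (f : MvPolynomial (Fin n) k) :
    apolarPairing k n (monomial m c) f = c * ((∏ i, ((m i).factorial : k)) * coeff m f) := by
  have h : monomial m c = c • basisMonomials (Fin n) k m := by simp [smul_monomial]
  rw [h, map_smul, apolarPairing, Module.Basis.constr_basis]
  simp

theorem coeff_pderiv_pow (i : Fin n) (e : ℕ) (v : Fin n →₀ ℕ) (f : MvPolynomial (Fin n) k) :
    coeff v ((((pderiv i).toLinearMap : Module.End k (MvPolynomial (Fin n) k)) ^ e) f) =
      coeff (v + Finsupp.single i e) f * ((v i + 1).ascFactorial e : k) := by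
  induction e generalizing f with
  | zero => simp
  | succ e ih =>
    rw [pow_succ, Module.End.mul_apply, ih, Derivation.coeFn_coe, coeff_pderiv, add_assoc,
      ← Finsupp.single_add, Nat.ascFactorial_succ]
    simp
    ring

theorem coeff_list_prod_pderiv_pow (m : Fin n →₀ ℕ) (l : List (Fin n)) (hl : l.Nodup)
    (v : Fin n →₀ ℕ) (f : MvPolynomial (Fin n) k) :
    coeff v ((l.map fun i =>
        ((pderiv i).toLinearMap : Module.End k (MvPolynomial (Fin n) k)) ^ m i).prod f) =
      coeff (v + (l.map fun i => Finsupp.single i (m i)).sum) f *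
        (l.map fun i => ((v i + 1).ascFactorial (m i) : k)).prod := by
  induction l generalizing v with
  | nil => simp
  | cons i l ih =>
    obtain ⟨hi, hl⟩ := List.nodup_cons.1 hl
    rw [List.map_cons, List.prod_cons, Module.End.mul_apply, coeff_pderiv_pow, ih hl,
      List.map_cons, List.sum_cons, List.map_cons, List.prod_cons, add_assoc]
    have h : l.map (fun j => (((v + Finsupp.single i (m i)) j + 1).ascFactorial (m j) : k)) =
        l.map fun j => ((v j + 1).ascFactorial (m j) : k) := by
      refine List.map_congr_left fun j hj => ?_
      have : i ≠ j := fun h => hi (h ▸ hj)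
      simp [this]
    rw [h]
    ring

theorem constantCoeff_monDiff (m : Fin n →₀ ℕ) (f : MvPolynomial (Fin n) k) :
    constantCoeff (monDiff k m f) = (∏ i, ((m i).factorial : k)) * coeff m f := by
  rw [constantCoeff_eq, monDiff, List.ofFn_eq_map,
    coeff_list_prod_pderiv_pow m _ (List.nodup_finRange n), ← List.ofFn_eq_map, ← List.ofFn_eq_map,
    List.sum_ofFn, List.prod_ofFn, Finsupp.univ_sum_single, zero_add, mul_comm]
  simp [Nat.one_ascFactorial]

theorem constantCoeff_apolar (p f : MvPolynomial (Fin n) k) :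
    constantCoeff (apolar p f) = apolarPairing k n p f := by
  conv_rhs => rw [p.as_sum]
  simp_rw [map_sum, LinearMap.sum_apply, apolarPairing_monomial, apolar, map_sum,
    constantCoeff_smul, constantCoeff_monDiff, smul_eq_mul]

theorem apolarPairing_eq_zero_of_isHomogeneous {p f : MvPolynomial (Fin n) k} {e e' : ℕ}
    (hp : p.IsHomogeneous e) (hf : f.IsHomogeneous e') (he : e ≠ e') :
    apolarPairing k n p f = 0 := by
  rw [p.as_sum, map_sum, LinearMap.sum_apply]
  refine Finset.sum_eq_zero fun m hm => ?_
  rw [apolarPairing_monomial, hf.coeff_eq_zero, mul_zero, mul_zero]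
  rwa [hp.degree_eq_sum_deg_support hm] at he

theorem apolarPairing_mul_mul {s t : Set (Fin n)} (hst : Disjoint s t)
    {p₁ f₁ p₂ f₂ : MvPolynomial (Fin n) k} (hp₁ : p₁ ∈ supported k s) (hf₁ : f₁ ∈ supported k s)
    (hp₂ : p₂ ∈ supported k t) (hf₂ : f₂ ∈ supported k t) :
    apolarPairing k n (p₁ * p₂) (f₁ * f₂) =
      apolarPairing k n p₁ f₁ * apolarPairing k n p₂ f₂ := by
  refine supported_induction (P := fun p₁ => apolarPairing k n (p₁ * p₂) (f₁ * f₂) =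
    apolarPairing k n p₁ f₁ * apolarPairing k n p₂ f₂) (by simp)
    (fun p q hp hq => by simp only [add_mul, map_add, LinearMap.add_apply, hp, hq]) ?_ hp₁
  intro m₁ a₁ hm₁
  refine supported_induction (P := fun p₂ => apolarPairing k n (_ * p₂) (f₁ * f₂) =
    apolarPairing k n _ f₁ * apolarPairing k n p₂ f₂) (by simp)
    (fun p q hp hq => by simp only [mul_add, map_add, LinearMap.add_apply, hp, hq]) ?_ hp₂
  intro m₂ a₂ hm₂
  refine supported_induction (P := fun f₁ => apolarPairing k n _ (f₁ * f₂) =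
    apolarPairing k n _ f₁ * apolarPairing k n _ f₂) (by simp)
    (fun p q hp hq => by simp only [add_mul, map_add, hp, hq]) ?_ hf₁
  intro u₁ b₁ hu₁
  refine supported_induction (P := fun f₂ => apolarPairing k n _ (_ * f₂) =
    apolarPairing k n _ _ * apolarPairing k n _ f₂) (by simp)
    (fun p q hp hq => by simp only [mul_add, map_add, hp, hq]) ?_ hf₂
  intro u₂ b₂ hu₂
  have hcase (i) : i ∉ s ∨ i ∉ t := by
    by_contra! h
    exact Set.disjoint_left.1 hst h.1 h.2
  have hfac : ∏ i, (((m₁ + m₂) i).factorial : k) =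
      (∏ i, ((m₁ i).factorial : k)) * ∏ i, ((m₂ i).factorial : k) := by
    rw [← Finset.prod_mul_distrib]
    refine Finset.prod_congr rfl fun i _ => ?_
    rcases hcase i with h | h
    · simp [hm₁ i h]
    · simp [hm₂ i h]
  have hiff : u₁ + u₂ = m₁ + m₂ ↔ u₁ = m₁ ∧ u₂ = m₂ := by
    refine ⟨fun h => ?_, fun ⟨h1, h2⟩ => by rw [h1, h2]⟩
    have h' (i) : u₁ i + u₂ i = m₁ i + m₂ i := DFunLike.congr_fun h i
    constructor <;> ext i <;> have := h' i <;> rcases hcase i with h | h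
    · rw [hu₁ i h, hm₁ i h]
    · rw [hu₂ i h, hm₂ i h] at this; omega
    · rw [hu₁ i h, hm₁ i h] at this; omega
    · rw [hu₂ i h, hm₂ i h]
  rw [monomial_mul, monomial_mul, apolarPairing_monomial, apolarPairing_monomial,
    apolarPairing_monomial, hfac, coeff_monomial, coeff_monomial, coeff_monomial]
  simp only [hiff]
  by_cases h1 : u₁ = m₁ <;> by_cases h2 : u₂ = m₂ <;> simp [h1, h2]
  ring

theorem eq_of_apolarPairing_monomial_eq [CharZero k] {f g : MvPolynomial (Fin n) k} {e : ℕ}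
    (hf : f.IsHomogeneous e) (hg : g.IsHomogeneous e)
    (h : ∀ m : Fin n →₀ ℕ, m.degree = e →
      apolarPairing k n (monomial m 1) f = apolarPairing k n (monomial m 1) g) : f = g := by
  ext m
  by_cases hm : m.degree = e
  · have hfac : (∏ i, ((m i).factorial : k)) ≠ 0 :=
      Finset.prod_ne_zero_iff.2 fun i _ => Nat.cast_ne_zero.2 (Nat.factorial_ne_zero _)
    have := h m hm
    rw [apolarPairing_monomial, apolarPairing_monomial, one_mul, one_mul] at this
    exact mul_left_cancel₀ hfac this
  · rw [hf.coeff_eq_zero hm, hg.coeff_eq_zero hm]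

/-- A form which annihilates an ideal containing two ideals in complementary sets of variables,
each having a socle generator, is determined by its value on the product of the generators. -/
theorem eq_choose_mul_mul [CharZero k] {s t : Set (Fin n)} (hst : Disjoint s t)
    (hcov : s ∪ t = Set.univ) {N₁ N₂ : ℕ} {I : Ideal (MvPolynomial (Fin n) k)}
    {I₁ : Ideal (supported k s)} {I₂ : Ideal (supported k t)}
    (hI₁ : ∀ q ∈ I₁, (q : MvPolynomial (Fin n) k) ∈ I)
    (hI₂ : ∀ q ∈ I₂, (q : MvPolynomial (Fin n) k) ∈ I)
    {J₁ : supported k s} {J₂ : supported k t}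
    (hJ₁ : (J₁ : MvPolynomial (Fin n) k).IsHomogeneous N₁)
    (hJ₂ : (J₂ : MvPolynomial (Fin n) k).IsHomogeneous N₂)
    (htop₁ : ∀ (p : supported k s) (e : ℕ), (p : MvPolynomial (Fin n) k).IsHomogeneous e →
      N₁ < e → p ∈ I₁)
    (htop₂ : ∀ (p : supported k t) (e : ℕ), (p : MvPolynomial (Fin n) k).IsHomogeneous e →
      N₂ < e → p ∈ I₂)
    (hsoc₁ : ∀ p : supported k s, (p : MvPolynomial (Fin n) k).IsHomogeneous N₁ →
      ∃ c : k, p - c • J₁ ∈ I₁)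
    (hsoc₂ : ∀ p : supported k t, (p : MvPolynomial (Fin n) k).IsHomogeneous N₂ →
      ∃ c : k, p - c • J₂ ∈ I₂)
    {F F₁ F₂ : MvPolynomial (Fin n) k} (hF : F.IsHomogeneous (N₁ + N₂))
    (hF₁ : F₁.IsHomogeneous N₁) (hF₂ : F₂.IsHomogeneous N₂)
    (hF₁s : F₁ ∈ supported k s) (hF₂t : F₂ ∈ supported k t)
    (hFI : ∀ q ∈ I, q.IsHomogeneous (N₁ + N₂) → apolarPairing k n q F = 0)
    (hFI₁ : ∀ q ∈ I₁, (q : MvPolynomial (Fin n) k).IsHomogeneous N₁ →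
      apolarPairing k n (q : MvPolynomial (Fin n) k) F₁ = 0)
    (hFI₂ : ∀ q ∈ I₂, (q : MvPolynomial (Fin n) k).IsHomogeneous N₂ →
      apolarPairing k n (q : MvPolynomial (Fin n) k) F₂ = 0)
    (hFJ : apolarPairing k n (J₁ * J₂) F = ((N₁ + N₂).factorial : k))
    (hFJ₁ : apolarPairing k n J₁ F₁ = (N₁.factorial : k))
    (hFJ₂ : apolarPairing k n J₂ F₂ = (N₂.factorial : k)) :
    F = ((N₁ + N₂).choose N₁ : MvPolynomial (Fin n) k) * F₁ * F₂ := by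
  have hG : (((N₁ + N₂).choose N₁ : MvPolynomial (Fin n) k) * F₁ * F₂).IsHomogeneous (N₁ + N₂) := by
    rw [mul_assoc, ← nsmul_eq_mul]
    exact nsmul_mem (S := homogeneousSubmodule _ k (N₁ + N₂)) (hF₁.mul hF₂) _
  refine eq_of_apolarPairing_monomial_eq hF hG fun m hm => ?_
  rw [mul_assoc, ← nsmul_eq_mul, map_nsmul]
  classical
  set m₁ := m.filter (· ∈ s) with hm₁
  set m₂ := m.filter (¬ · ∈ s) with hm₂
  have hmm : m₁ + m₂ = m := Finsupp.filter_add_filter_not m _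
  have hdeg : m₁.degree + m₂.degree = N₁ + N₂ := by rw [← map_add, hmm, hm]
  have hp₁ : monomial m₁ (1 : k) ∈ supported k s := by
    rw [mem_supported, vars_monomial one_ne_zero]
    intro i hi
    by_contra his
    simp [hm₁, his] at hi
  have hp₂ : monomial m₂ (1 : k) ∈ supported k t := by
    rw [mem_supported, vars_monomial one_ne_zero]
    intro i hi
    have : i ∈ s ∪ t := hcov ▸ Set.mem_univ i
    refine this.resolve_left fun his => ?_
    simp [hm₂, his] at hi
  have hh₁ : (monomial m₁ (1 : k)).IsHomogeneous m₁.degree := isHomogeneous_monomial _ rfl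
  have hh₂ : (monomial m₂ (1 : k)).IsHomogeneous m₂.degree := isHomogeneous_monomial _ rfl
  have hp : monomial m (1 : k) = monomial m₁ 1 * monomial m₂ 1 := by simp [monomial_mul, hmm]
  have hhp : (monomial m₁ (1 : k) * monomial m₂ 1).IsHomogeneous (N₁ + N₂) := hdeg ▸ hh₁.mul hh₂
  rw [hp, apolarPairing_mul_mul hst hp₁ hF₁s hp₂ hF₂t]
  rcases lt_trichotomy N₁ m₁.degree with h | h | h
  · rw [apolarPairing_eq_zero_of_isHomogeneous hh₁ hF₁ h.ne', zero_mul, smul_zero]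
    exact hFI _ (Ideal.mul_mem_right _ _ (hI₁ _ (htop₁ ⟨_, hp₁⟩ _ hh₁ h))) hhp
  · have h' : N₂ = m₂.degree := by omega
    rw [← h] at hh₁
    rw [← h'] at hh₂
    obtain ⟨c₁, hc₁⟩ := hsoc₁ ⟨_, hp₁⟩ hh₁
    obtain ⟨c₂, hc₂⟩ := hsoc₂ ⟨_, hp₂⟩ hh₂
    have hcJ₁ : (c₁ • (J₁ : MvPolynomial (Fin n) k)).IsHomogeneous N₁ :=
      (homogeneousSubmodule _ k N₁).smul_mem c₁ hJ₁
    have hcJ₂ : (c₂ • (J₂ : MvPolynomial (Fin n) k)).IsHomogeneous N₂ :=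
      (homogeneousSubmodule _ k N₂).smul_mem c₂ hJ₂
    have e₁ := hFI₁ _ hc₁ (hh₁.sub hcJ₁)
    have e₂ := hFI₂ _ hc₂ (hh₂.sub hcJ₂)
    have e : apolarPairing k n (monomial m₁ (1 : k) * monomial m₂ 1 -
        (c₁ • (J₁ : MvPolynomial (Fin n) k)) * (c₂ • (J₂ : MvPolynomial (Fin n) k))) F = 0 := by
      refine hFI _ ?_ (hhp.sub (hcJ₁.mul hcJ₂))
      have : monomial m₁ (1 : k) * monomial m₂ 1 -
          (c₁ • (J₁ : MvPolynomial (Fin n) k)) * (c₂ • (J₂ : MvPolynomial (Fin n) k)) =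
          (monomial m₁ (1 : k) - c₁ • (J₁ : MvPolynomial (Fin n) k)) * monomial m₂ 1 +
          (c₁ • (J₁ : MvPolynomial (Fin n) k)) *
            (monomial m₂ (1 : k) - c₂ • (J₂ : MvPolynomial (Fin n) k)) := by ring
      rw [this]
      exact I.add_mem (Ideal.mul_mem_right _ _ (hI₁ _ hc₁)) (Ideal.mul_mem_left _ _ (hI₂ _ hc₂))
    replace e₁ : apolarPairing k n (monomial m₁ (1 : k) - c₁ • (J₁ : MvPolynomial (Fin n) k)) F₁ = 0
      := e₁
    replace e₂ : apolarPairing k n (monomial m₂ (1 : k) - c₂ • (J₂ : MvPolynomial (Fin n) k)) F₂ = 0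
      := e₂
    rw [map_sub, map_smul, LinearMap.sub_apply, LinearMap.smul_apply, sub_eq_zero, hFJ₁] at e₁
    rw [map_sub, map_smul, LinearMap.sub_apply, LinearMap.smul_apply, sub_eq_zero, hFJ₂] at e₂
    rw [smul_mul_smul_comm, map_sub, map_smul, LinearMap.sub_apply, LinearMap.smul_apply,
      sub_eq_zero, hFJ] at e
    rw [e, e₁, e₂, ← Nat.add_choose_mul_factorial_mul_factorial N₁ N₂,
      ← Nat.choose_symm_add]
    simp only [smul_eq_mul, nsmul_eq_mul, Nat.cast_mul]
    ring
  · have h' : N₂ < m₂.degree := by omega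
    rw [apolarPairing_eq_zero_of_isHomogeneous hh₂ hF₂ h'.ne', mul_zero, smul_zero]
    exact hFI _ (Ideal.mul_mem_left _ _ (hI₂ _ (htop₂ ⟨_, hp₂⟩ _ hh₂ h'))) hhp

end Pairing

/-- Lemma 2.9: the associated form of a direct sum `g_1,…,g_a ∈ k[x_1,…,x_a]`,
`g_{a+1},…,g_n ∈ k[x_{a+1},…,x_n]` of regular sequences of degree-`d` forms is
`A(g_1,…,g_n) = binom(n(d-1), a(d-1)) ⬝ A(g_1,…,g_a) ⬝ A(g_{a+1},…,g_n)`.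
Here `F`, `F₁`, `F₂` are characterized as the respective associated forms: they kill the
degree-socle part of the respective ideals under apolarity and pair with the Jacobian
determinants to the appropriate factorials. -/
theorem stmt16 {k : Type*} [Field k] [CharZero k] {n d a : ℕ} (hd : 2 ≤ d)
    (ha1 : 1 ≤ a) (ha2 : a ≤ n - 1)
    (g : Fin n → MvPolynomial (Fin n) k)
    (hhom : ∀ i, (g i).IsHomogeneous d)
    (hg1 : ∀ i : Fin n, (i : ℕ) < a → g i ∈ MvPolynomial.supported k {l : Fin n | (l : ℕ) < a})
    (hg2 : ∀ i : Fin n, a ≤ (i : ℕ) → g i ∈ MvPolynomial.supported k {l : Fin n | a ≤ (l : ℕ)})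
    (hreg1 : RingTheory.Sequence.IsRegular (MvPolynomial.supported k {l : Fin n | (l : ℕ) < a})
      (List.ofFn fun j : Fin a =>
        (⟨g (Fin.castLE (ha2.trans (Nat.sub_le n 1)) j), hg1 (Fin.castLE (ha2.trans (Nat.sub_le n 1)) j) j.isLt⟩ :
          MvPolynomial.supported k {l : Fin n | (l : ℕ) < a})))
    (hreg2 : RingTheory.Sequence.IsRegular (MvPolynomial.supported k {l : Fin n | a ≤ (l : ℕ)})
      (List.ofFn fun j : Fin (n - a) =>
        (⟨g ⟨a + (j : ℕ), by have := j.isLt; omega⟩,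
          hg2 ⟨a + (j : ℕ), by have := j.isLt; omega⟩ (Nat.le_add_right a j)⟩ :
          MvPolynomial.supported k {l : Fin n | a ≤ (l : ℕ)})))
    (F : MvPolynomial (Fin n) k)
    (hFhom : F.IsHomogeneous (n * (d - 1)))
    (hFperp : ∀ q ∈ Ideal.span (Set.range g), q.IsHomogeneous (n * (d - 1)) →
      apolar q F = 0)
    (hFjac : apolar
        (Matrix.det (Matrix.of fun r s : Fin n => MvPolynomial.pderiv s (g r))) F =
      ((n * (d - 1)).factorial : MvPolynomial (Fin n) k))
    (F₁ : MvPolynomial (Fin n) k)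
    (hF₁supp : F₁ ∈ MvPolynomial.supported k {l : Fin n | (l : ℕ) < a})
    (hF₁hom : F₁.IsHomogeneous (a * (d - 1)))
    (hF₁perp : ∀ q : MvPolynomial.supported k {l : Fin n | (l : ℕ) < a},
      q ∈ Ideal.span {q' : MvPolynomial.supported k {l : Fin n | (l : ℕ) < a} |
        ∃ j : Fin a, (q' : MvPolynomial (Fin n) k) = g (Fin.castLE (ha2.trans (Nat.sub_le n 1)) j)} →
      (q : MvPolynomial (Fin n) k).IsHomogeneous (a * (d - 1)) →
      apolar (q : MvPolynomial (Fin n) k) F₁ = 0)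
    (hF₁jac : apolar
        (Matrix.det (Matrix.of fun r s : Fin a =>
          MvPolynomial.pderiv (Fin.castLE (ha2.trans (Nat.sub_le n 1)) s) (g (Fin.castLE (ha2.trans (Nat.sub_le n 1)) r)))) F₁ =
      ((a * (d - 1)).factorial : MvPolynomial (Fin n) k))
    (F₂ : MvPolynomial (Fin n) k)
    (hF₂supp : F₂ ∈ MvPolynomial.supported k {l : Fin n | a ≤ (l : ℕ)})
    (hF₂hom : F₂.IsHomogeneous ((n - a) * (d - 1)))
    (hF₂perp : ∀ q : MvPolynomial.supported k {l : Fin n | a ≤ (l : ℕ)},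
      q ∈ Ideal.span {q' : MvPolynomial.supported k {l : Fin n | a ≤ (l : ℕ)} |
        ∃ j : Fin (n - a), (q' : MvPolynomial (Fin n) k) = g ⟨a + (j : ℕ), by have := j.isLt; omega⟩} →
      (q : MvPolynomial (Fin n) k).IsHomogeneous ((n - a) * (d - 1)) →
      apolar (q : MvPolynomial (Fin n) k) F₂ = 0)
    (hF₂jac : apolar
        (Matrix.det (Matrix.of fun r s : Fin (n - a) =>
          MvPolynomial.pderiv (⟨a + (s : ℕ), by have := s.isLt; omega⟩ : Fin n)
            (g ⟨a + (r : ℕ), by have := r.isLt; omega⟩))) F₂ =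
      (((n - a) * (d - 1)).factorial : MvPolynomial (Fin n) k)) :
    F = ((n * (d - 1)).choose (a * (d - 1)) : MvPolynomial (Fin n) k) * F₁ * F₂ := by
  have han : a ≤ n := ha2.trans (Nat.sub_le n 1)
  set s : Set (Fin n) := {l : Fin n | (l : ℕ) < a} with hs
  set t : Set (Fin n) := {l : Fin n | a ≤ (l : ℕ)} with ht
  have hst : Disjoint s t := by
    rw [Set.disjoint_left]
    intro i hi hi'
    exact not_le.2 (show (i : ℕ) < a from hi) hi'
  have hcov : s ∪ t = Set.univ := Set.eq_univ_of_forall fun i => lt_or_ge (i : ℕ) a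
  let ι₁ : Fin a → Fin n := Fin.castLE han
  let ι₂ : Fin (n - a) → Fin n := fun j => ⟨a + (j : ℕ), by have := j.isLt; omega⟩
  have hs' : Set.range ι₁ = s := by
    ext i
    exact ⟨by rintro ⟨j, rfl⟩; exact j.isLt, fun h => ⟨⟨i, h⟩, rfl⟩⟩
  have ht' : Set.range ι₂ = t := by
    ext i
    refine ⟨by rintro ⟨j, rfl⟩; exact Nat.le_add_right _ _, fun h => ?_⟩
    have hi : a ≤ (i : ℕ) := h
    exact ⟨⟨i - a, by omega⟩, Fin.ext (Nat.add_sub_cancel' hi)⟩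
  have hι₁ : Function.Injective ι₁ := Fin.castLE_injective han
  have hι₂ : Function.Injective ι₂ := fun i j h => by
    have := congrArg Fin.val h
    exact Fin.ext (by simpa [ι₂] using this)
  have hcs : Nat.card s = a := by
    rw [← hs', Nat.card_range_of_injective hι₁, Nat.card_fin]
  have hct : Nat.card t = n - a := by
    rw [← ht', Nat.card_range_of_injective hι₂, Nat.card_fin]
  let G₁ : Fin a → supported k s := fun j => ⟨g (ι₁ j), hg1 (ι₁ j) j.isLt⟩
  let G₂ : Fin (n - a) → supported k t := fun j => ⟨g (ι₂ j), hg2 (ι₂ j) (Nat.le_add_right a j)⟩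
  obtain ⟨top₁, soc₁⟩ := socle_of_completeIntersection_supported s hcs (by omega) G₁
    (fun j => hhom _) hreg1.toIsWeaklyRegular
  obtain ⟨top₂, soc₂⟩ := socle_of_completeIntersection_supported t hct (by omega) G₂
    (fun j => hhom _) hreg2.toIsWeaklyRegular
  set M₁ : Matrix (Fin a) (Fin a) (MvPolynomial (Fin n) k) :=
    Matrix.of fun r s => pderiv (ι₁ s) (g (ι₁ r)) with hM₁
  set M₂ : Matrix (Fin (n - a)) (Fin (n - a)) (MvPolynomial (Fin n) k) :=
    Matrix.of fun r s => pderiv (ι₂ s) (g (ι₂ r)) with hM₂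
  let J₁ : supported k s :=
    ⟨M₁.det, det_mem_subalgebra _ _ fun i j => pderiv_mem_supported (G₁ i).2 _⟩
  let J₂ : supported k t :=
    ⟨M₂.det, det_mem_subalgebra _ _ fun i j => pderiv_mem_supported (G₂ i).2 _⟩
  have hJ₁ : (J₁ : MvPolynomial (Fin n) k).IsHomogeneous (a * (d - 1)) :=
    isHomogeneous_det _ fun i j => (hhom _).pderiv
  have hJ₂ : (J₂ : MvPolynomial (Fin n) k).IsHomogeneous ((n - a) * (d - 1)) :=
    isHomogeneous_det _ fun i j => (hhom _).pderiv
  have hset₁ : {q' : supported k s | ∃ j : Fin a, (q' : MvPolynomial (Fin n) k) = g (ι₁ j)} =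
      Set.range G₁ := by
    ext q
    exact ⟨fun ⟨j, hj⟩ => ⟨j, Subtype.ext hj.symm⟩, fun ⟨j, hj⟩ => ⟨j, by rw [← hj]⟩⟩
  have hset₂ : {q' : supported k t |
      ∃ j : Fin (n - a), (q' : MvPolynomial (Fin n) k) = g (ι₂ j)} = Set.range G₂ := by
    ext q
    exact ⟨fun ⟨j, hj⟩ => ⟨j, Subtype.ext hj.symm⟩, fun ⟨j, hj⟩ => ⟨j, by rw [← hj]⟩⟩
  have perp₁ : ∀ q ∈ Ideal.span (Set.range G₁),
      (q : MvPolynomial (Fin n) k).IsHomogeneous (a * (d - 1)) →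
      apolar (q : MvPolynomial (Fin n) k) F₁ = 0 :=
    fun q hq => hF₁perp q (by rw [← hset₁] at hq; exact hq)
  have perp₂ : ∀ q ∈ Ideal.span (Set.range G₂),
      (q : MvPolynomial (Fin n) k).IsHomogeneous ((n - a) * (d - 1)) →
      apolar (q : MvPolynomial (Fin n) k) F₂ = 0 :=
    fun q hq => hF₂perp q (by rw [← hset₂] at hq; exact hq)
  have hJI₁ : J₁ ∉ Ideal.span (Set.range G₁) := fun h => by
    have := hF₁jac.symm.trans (perp₁ J₁ h hJ₁)
    exact Nat.factorial_ne_zero _ (Nat.cast_eq_zero.1 this)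
  have hJI₂ : J₂ ∉ Ideal.span (Set.range G₂) := fun h => by
    have := hF₂jac.symm.trans (perp₂ J₂ h hJ₂)
    exact Nat.factorial_ne_zero _ (Nat.cast_eq_zero.1 this)
  have hdet : (Matrix.of fun r s : Fin n => pderiv s (g r)).det = M₁.det * M₂.det := by
    let e : Fin a ⊕ Fin (n - a) ≃ Fin n := finSumFinEquiv.trans (finCongr (by omega))
    have he₁ (j) : e (Sum.inl j) = ι₁ j := Fin.ext (by simp [e, ι₁])
    have he₂ (j) : e (Sum.inr j) = ι₂ j := Fin.ext (by simp [e, ι₂])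
    rw [← Matrix.det_submatrix_equiv_self e, ← Matrix.det_fromBlocks_zero₂₁ M₁ 0 M₂]
    congr 1
    ext1 i j
    rcases i with i | i <;> rcases j with j | j
    · simp [he₁, hM₁]
    · simp only [Matrix.submatrix_apply, Matrix.of_apply, he₁, he₂, Matrix.fromBlocks_apply₁₂,
        Matrix.zero_apply]
      refine pderiv_eq_zero_of_notMem_vars fun h => ?_
      exact Set.disjoint_left.1 hst (mem_supported.1 (G₁ i).2 h) (Nat.le_add_right a j)
    · simp only [Matrix.submatrix_apply, Matrix.of_apply, he₁, he₂, Matrix.fromBlocks_apply₂₁,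
        Matrix.zero_apply]
      refine pderiv_eq_zero_of_notMem_vars fun h => ?_
      exact Set.disjoint_left.1 hst j.isLt (mem_supported.1 (G₂ i).2 h)
    · simp [he₂, hM₂]
  have hN : n * (d - 1) = a * (d - 1) + (n - a) * (d - 1) := by
    rw [← add_mul, Nat.add_sub_cancel' han]
  have span_le {u : Set (Fin n)} {m : ℕ} (G : Fin m → supported k u)
      (hG : ∀ j, ∃ i, (G j : MvPolynomial (Fin n) k) = g i) :
      ∀ q ∈ Ideal.span (Set.range G), (q : MvPolynomial (Fin n) k) ∈ Ideal.span (Set.range g) := by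
    have h : Ideal.span (Set.range G) ≤
        (Ideal.span (Set.range g)).comap (supported k u).val := by
      rw [Ideal.span_le]
      rintro _ ⟨j, rfl⟩
      obtain ⟨i, hi⟩ := hG j
      exact Ideal.subset_span ⟨i, hi.symm⟩
    exact fun q hq => h hq
  rw [hdet] at hFjac
  rw [hN] at hFhom hFperp hFjac ⊢
  refine eq_choose_mul_mul hst hcov (span_le G₁ fun j => ⟨_, rfl⟩) (span_le G₂ fun j => ⟨_, rfl⟩)
    hJ₁ hJ₂ top₁ top₂ (fun p hp => soc₁ p J₁ hp hJ₁ hJI₁) (fun p hp => soc₂ p J₂ hp hJ₂ hJI₂)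
    hFhom hF₁hom hF₂hom hF₁supp hF₂supp ?_ ?_ ?_ ?_ ?_ ?_
  · intro q hq hqh
    rw [← constantCoeff_apolar, hFperp q hq hqh, map_zero]
  · intro q hq hqh
    rw [← constantCoeff_apolar, perp₁ q hq hqh, map_zero]
  · intro q hq hqh
    rw [← constantCoeff_apolar, perp₂ q hq hqh, map_zero]
  · rw [← constantCoeff_apolar]
    exact (congrArg constantCoeff hFjac).trans (map_natCast _ _)
  · rw [← constantCoeff_apolar]
    exact (congrArg constantCoeff hF₁jac).trans (map_natCast _ _)
  · rw [← constantCoeff_apolar]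
    exact (congrArg constantCoeff hF₂jac).trans (map_natCast _ _)
end
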